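/- arXiv:2408.11694 — 4 statements merged into one kernel-verified Lean document; each statement's English description precedes it below -/
import Mathlib

section
/- Let B be a real Banach space, V a nonempty weakly compact convex subset of B having normal structure, (Ω, 𝓕, P) a probability space, and 𝒯 a family of pairwise commuting strong random nonexpansive operators from Ω × V to V. Then there exists a strong random element x⁰ : Ω → B with x⁰(ω) ∈ V for all ω ∈ Ω such that for each T ∈ 𝒯, T(ω, x⁰(ω)) = x⁰(ω) for almost all ω ∈ Ω. -/
open MeasureTheory Set Filter Function
open scoped Classical

noncomputable section

namespace RNM


variable {B : Type*} [NormedAddCommGroup B] [NormedSpace ℝ B]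

/-- `sup_{y ∈ K} ‖x − y‖`. -/
def supDist (K : Set B) (x : B) : ℝ := ⨆ y : K, ‖x - (y : B)‖

/-- The Chebyshev radius `r(K,K)` of `K`. -/
def chebRadius (K : Set B) : ℝ := ⨅ z : K, supDist K (z : B)

/-- The Chebyshev center `c(K,K)` of `K`. -/
def chebCenter (K : Set B) : Set B := {x ∈ K | supDist K x = chebRadius K}

/-- `K` has normal structure: every closed convex subset of `K` containing more than one
point has a nondiametral point. -/
def NormalStructure (K : Set B) : Prop :=
  ∀ F, F ⊆ K → IsClosed F → Convex ℝ F → F.Nontrivial →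
    ∃ x ∈ F, supDist F x < Metric.diam F

/-- `K` is compact in the weak topology of `B`. -/
def WeaklyCompact (K : Set B) : Prop := IsCompact (toWeakSpace ℝ B '' K)


section Helpers

open scoped Topology ENNReal

set_option linter.unusedSectionVars false

/-- A closed midpoint-convex set is convex. -/
theorem convex_of_mid {E : Type*} [NormedAddCommGroup E] [NormedSpace ℝ E] {S : Set E}
    (hc : IsClosed S) (hm : ∀ x ∈ S, ∀ y ∈ S, midpoint ℝ x y ∈ S) : Convex ℝ S := by
  rw [convex_iff_segment_subset]
  intro x hx y hy
  rw [segment_eq_image_lineMap]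
  rintro _ ⟨t, ht, rfl⟩
  set g : ℝ → E := fun t => AffineMap.lineMap x y t with hg
  have hgc : Continuous g := AffineMap.lineMap_continuous
  -- the closed set of good parameters
  have key : ∀ n : ℕ, ∀ k : ℕ, k ≤ 2 ^ n → g ((k : ℝ) / 2 ^ n) ∈ S := by
    intro n
    induction n with
    | zero =>
      intro k hk
      have : k = 0 ∨ k = 1 := by simp at hk; omega
      rcases this with rfl | rfl <;> simpa [hg]
    | succ n ih =>
      intro k hk
      have h1 : k / 2 ≤ 2 ^ n := by rw [pow_succ] at hk; omega
      have h2 : k - k / 2 ≤ 2 ^ n := by rw [pow_succ] at hk; omega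
      have := hm _ (ih _ h1) _ (ih _ h2)
      have e : midpoint ℝ (g (((k / 2 : ℕ) : ℝ) / 2 ^ n)) (g (((k - k / 2 : ℕ) : ℝ) / 2 ^ n))
          = g ((k : ℝ) / 2 ^ (n + 1)) := by
        rw [hg]
        rw [← AffineMap.map_midpoint]
        congr 1
        rw [midpoint_eq_smul_add]
        have : ((k / 2 : ℕ) : ℝ) + ((k - k / 2 : ℕ) : ℝ) = k := by
          rw [← Nat.cast_add]; congr 1; omega
        rw [← add_div, this, pow_succ]
        simp only [invOf_eq_inv, smul_eq_mul]
        field_simp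
      rwa [e] at this
  have hlim : Tendsto (fun n : ℕ => ((⌊t * 2 ^ n⌋₊ : ℕ) : ℝ) / 2 ^ n) atTop (𝓝 t) := by
    have h0 := (tendsto_nat_floor_mul_div_atTop (R := ℝ) ht.1)
    have h2 : Tendsto (fun n : ℕ => (2 : ℝ) ^ n) atTop atTop :=
      tendsto_pow_atTop_atTop_of_one_lt (by norm_num)
    exact h0.comp h2
  refine hc.mem_of_tendsto ((hgc.tendsto t).comp hlim) (Eventually.of_forall fun n => ?_)
  apply key
  have : t * 2 ^ n ≤ ((2 ^ n : ℕ) : ℝ) := by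
    push_cast
    nlinarith [ht.2, pow_pos (two_pos : (0 : ℝ) < 2) n]
  calc ⌊t * 2 ^ n⌋₊ ≤ ⌊((2 ^ n : ℕ) : ℝ)⌋₊ := Nat.floor_le_floor this
    _ = 2 ^ n := Nat.floor_natCast _

/-- Closing off under countably-valued finitary operations. -/
theorem exists_closed {X : Type*} (c : Finset X → Set X) (hc : ∀ F, (c F).Countable) :
    ∃ S : Set X, S.Countable ∧ ∀ F : Finset X, (F : Set X) ⊆ S → c F ⊆ S := by
  let st : Set X → Set X := fun S => S ∪ ⋃ F ∈ {F : Finset X | (F : Set X) ⊆ S}, c F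
  let S : ℕ → Set X := fun n => st^[n] ∅
  have hS : ∀ n, S (n + 1) = st (S n) := fun n => iterate_succ_apply' _ _ _
  have hmono : Monotone S := monotone_nat_of_le_succ fun n => by
    rw [hS]; exact subset_union_left
  refine ⟨⋃ n, S n, countable_iUnion fun n => ?_, fun F hF => ?_⟩
  · induction n with
    | zero => exact countable_empty
    | succ n ih =>
      rw [hS]
      refine ih.union (Countable.biUnion ?_ fun F _ => hc F)
      refine ((countable_ofPred_finite_subset ih).preimage
        (Finset.coe_injective (α := X))).mono fun F hF => ?_
      exact ⟨F.finite_toSet, hF⟩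
  · have : ∃ n, (F : Set X) ⊆ S n := by
      have := (directed_of_isDirected_le hmono : Directed (· ≤ ·) S).exists_mem_subset_of_finset_subset_biUnion (s := F)
      obtain ⟨n, hn⟩ := this (by simpa using hF)
      exact ⟨n, by simpa using hn⟩
    obtain ⟨n, hn⟩ := this
    intro x hx
    refine mem_iUnion.2 ⟨n + 1, ?_⟩
    rw [hS]
    exact Or.inr (mem_biUnion (show F ∈ {F : Finset X | (F : Set X) ⊆ S n} from hn) hx)

variable {Ω : Type*} [MeasurableSpace Ω] {P : Measure Ω} [IsProbabilityMeasure P]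

/-- Essential suprema of bounded families are attained by countable subfamilies. -/
theorem ess_bdd {I : Type*} [Nonempty I] (g : I → Ω → ℝ) (hg : ∀ i, AEMeasurable (g i) P)
    (C : ℝ) (hC : ∀ i ω, |g i ω| ≤ C) :
    ∃ s : ℕ → I, ∀ j, ∀ᵐ ω ∂P, g j ω ≤ ⨆ n, g (s n) ω := by
  have hbd : ∀ (s : ℕ → I) ω, BddAbove (range fun n => g (s n) ω) := fun s ω =>
    ⟨C, by rintro _ ⟨n, rfl⟩; exact (abs_le.1 (hC _ _)).2⟩
  let G : (ℕ → I) → Ω → ℝ := fun s ω => ⨆ n, g (s n) ω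
  have hGm : ∀ s, AEMeasurable (G s) P := fun s => AEMeasurable.iSup fun n => hg _
  have hGC : ∀ s ω, |G s ω| ≤ C := fun s ω => by
    rw [abs_le]
    exact ⟨(abs_le.1 (hC (s 0) ω)).1.trans (le_ciSup (hbd s ω) 0),
      ciSup_le fun n => (abs_le.1 (hC _ _)).2⟩
  have hGi : ∀ s, Integrable (G s) P := fun s =>
    Integrable.of_bound (hGm s).aestronglyMeasurable C (Eventually.of_forall fun ω => hGC s ω)
  let F : (ℕ → I) → ℝ := fun s => ∫ ω, G s ω ∂P
  have hFb : BddAbove (range F) := ⟨C, by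
    rintro _ ⟨s, rfl⟩
    calc F s ≤ ∫ _, C ∂P := integral_mono (hGi s) (integrable_const _)
            fun ω => (abs_le.1 (hGC s ω)).2
      _ = C := by simp⟩
  have : ∀ k : ℕ, ∃ s, (⨆ s, F s) - 1 / ((k : ℝ) + 1) < F s := fun k =>
    exists_lt_of_lt_ciSup (by have : 0 < 1 / ((k : ℝ) + 1) := by positivity
                              linarith)
  choose s hs using this
  let t : ℕ → I := fun n => s n.unpair.1 n.unpair.2
  have hst : ∀ k ω, G (s k) ω ≤ G t ω := fun k ω => ciSup_le fun n => by
    have := le_ciSup (hbd t ω) (Nat.pair k n)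
    simpa [t] using this
  have hFt : F t = ⨆ s, F s := by
    apply le_antisymm (le_ciSup hFb t)
    have h1 : ∀ k : ℕ, (⨆ s, F s) - 1 / ((k : ℝ) + 1) ≤ F t := fun k =>
      (hs k).le.trans (integral_mono (hGi _) (hGi _) (hst k))
    have h2 : Tendsto (fun k : ℕ => (⨆ s, F s) - 1 / ((k : ℝ) + 1)) atTop (𝓝 ((⨆ s, F s) - 0)) :=
      tendsto_const_nhds.sub tendsto_one_div_add_atTop_nhds_zero_nat
    rw [sub_zero] at h2
    exact le_of_tendsto' h2 h1
  refine ⟨t, fun j => ?_⟩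
  let u : ℕ → I := fun n => Nat.casesOn n j t
  have htu : ∀ ω, G t ω ≤ G u ω := fun ω => ciSup_le fun n => le_ciSup (hbd u ω) (n + 1)
  have hFu : F t = F u := by
    apply le_antisymm (integral_mono (hGi _) (hGi _) htu)
    exact (le_ciSup hFb u).trans hFt.ge
  have := (integral_eq_iff_of_ae_le (hGi t) (hGi u) (Eventually.of_forall htu)).1 hFu
  filter_upwards [this] with ω hω
  change _ ≤ G t ω
  rw [hω]
  exact le_ciSup (hbd u ω) 0

/-- Version without bounds. -/
theorem ess_gen {I : Type*} [Nonempty I] (g : I → Ω → ℝ) (hg : ∀ i, AEMeasurable (g i) P) :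
    ∃ s : ℕ → I, ∀ j, ∀ᵐ ω ∂P, ∀ c, (∀ n, g (s n) ω ≤ c) → g j ω ≤ c := by
  obtain ⟨s, hs⟩ := ess_bdd (P := P) (fun i ω => Real.arctan (g i ω))
    (fun i => Real.measurable_arctan.comp_aemeasurable (hg i)) (Real.pi / 2)
    (fun i ω => abs_le.2 ⟨(Real.neg_pi_div_two_lt_arctan _).le, (Real.arctan_lt_pi_div_two _).le⟩)
  refine ⟨s, fun j => ?_⟩
  filter_upwards [hs j] with ω hω c hc
  have : Real.arctan (g j ω) ≤ Real.arctan c :=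
    hω.trans (ciSup_le fun n => Real.arctan_strictMono.monotone (hc n))
  exact Real.arctan_strictMono.le_iff_le.1 this

/-- Summable integrals force a.e. convergence to zero. -/
theorem ae_tendsto_zero (e : ℕ → Ω → ℝ≥0∞) (he : ∀ n, AEMeasurable (e n) P)
    (h : ∑' n, ∫⁻ ω, e n ω ∂P ≠ ∞) : ∀ᵐ ω ∂P, Tendsto (fun n => e n ω) atTop (𝓝 0) := by
  rw [← lintegral_tsum he] at h
  filter_upwards [ae_lt_top' (AEMeasurable.tsum he) h] with ω hω
  exact ENNReal.tendsto_atTop_zero_of_tsum_ne_top hω.ne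

/-- Weakly compact sets are norm closed. -/
theorem WeaklyCompact.isClosed {V : Set B} (hV : WeaklyCompact V) : IsClosed V := by
  have h : IsClosed (toWeakSpace ℝ B '' V) := IsCompact.isClosed hV
  have := h.preimage (toWeakSpaceCLM ℝ B).continuous
  convert this using 1
  ext x
  simp [toWeakSpaceCLM_eq_toWeakSpace]

theorem continuous_dual_weak (φ : StrongDual ℝ B) :
    Continuous (fun x : WeakSpace ℝ B => φ ((toWeakSpace ℝ B).symm x)) :=
  WeakBilin.eval_continuous (topDualPairing ℝ B).flip φ

/-- Weakly compact sets are bounded. -/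
theorem WeaklyCompact.bounded {V : Set B} (hV : WeaklyCompact V) :
    ∃ C : ℝ, 0 ≤ C ∧ ∀ x ∈ V, ‖x‖ ≤ C := by
  have h := banach_steinhaus (𝕜 := ℝ) (𝕜₂ := ℝ) (σ₁₂ := RingHom.id ℝ) (ι := V)
    (g := fun x => NormedSpace.inclusionInDoubleDual ℝ B (x : B)) (fun φ => by
      have hb : IsCompact ((fun x : WeakSpace ℝ B => φ ((toWeakSpace ℝ B).symm x)) ''
        (toWeakSpace ℝ B '' V)) := IsCompact.image hV (continuous_dual_weak φ)
      obtain ⟨C, hC⟩ := hb.isBounded.exists_norm_le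
      refine ⟨C, fun x => ?_⟩
      apply hC
      exact ⟨_, ⟨x, x.2, rfl⟩, by simp⟩)
  obtain ⟨C, hC⟩ := h
  refine ⟨max C 0, le_max_right _ _, fun x hx => le_max_of_le_left ?_⟩
  have := hC ⟨x, hx⟩
  rwa [show ‖NormedSpace.inclusionInDoubleDual ℝ B x‖ = ‖x‖ from
    (NormedSpace.inclusionInDoubleDualLi (𝕜 := ℝ) (E := B)).norm_map x] at this

/-- Brodskii and Milman type argument. -/
theorem diametral_seq {V : Set B} (hVc : IsClosed V) (hVconv : Convex ℝ V)
    (hVns : NormalStructure V) (x a : ℕ → B) (hx : ∀ n, x n ∈ V) (ha0 : a 0 = x 0)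
    (ha : ∀ n, a (n + 1) = midpoint ℝ (a n) (x (n + 1))) (ρ : ℝ)
    (hd : ∀ i j, ‖x i - x j‖ ≤ ρ) (e : ℕ → ℝ) (he : ∀ n, ρ - e n ≤ ‖a n - x (n + 1)‖)
    (hlim : Tendsto (fun n => 2 ^ n * e n) atTop (𝓝 0)) : ρ ≤ 0 := by
  by_contra hρ
  push Not at hρ
  have he0 : Tendsto e atTop (𝓝 0) := by
    have h2 : Tendsto (fun n : ℕ => ((1 : ℝ) / 2) ^ n) atTop (𝓝 0) :=
      tendsto_pow_atTop_nhds_zero_of_lt_one (by norm_num) (by norm_num)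
    have := h2.mul hlim
    simp only [mul_zero] at this
    refine this.congr fun n => ?_
    rw [← mul_assoc, ← mul_pow]; norm_num
  -- halfspace estimate
  have half : ∀ (n : ℕ) (g : B →ₗ[ℝ] ℝ) (z : B) (ε : ℝ), (∀ i, g (z - x i) ≤ ρ) →
      ρ - ε ≤ g (z - a n) → ∀ i ≤ n, ρ - 2 ^ n * ε ≤ g (z - x i) := by
    intro n g z
    have hga : ∀ n, (∀ i, g (z - x i) ≤ ρ) → g (z - a n) ≤ ρ := by
      intro n hi
      induction n with
      | zero => rw [ha0]; exact hi 0
      | succ n ih =>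
        rw [ha, midpoint_eq_smul_add]
        have := hi (n + 1)
        simp only [map_sub, map_smul, map_add, invOf_eq_inv, smul_eq_mul] at *
        linarith
    induction n with
    | zero =>
      intro ε hi h i hi0
      obtain rfl : i = 0 := by omega
      rw [ha0] at h; simpa using h
    | succ n ih =>
      intro ε hi h i hin
      have h1 := hga n hi
      have h2 := hi (n + 1)
      rw [ha, midpoint_eq_smul_add] at h
      have e1 : g (z - (⅟2 : ℝ) • (a n + x (n + 1)))
          = (g (z - a n) + g (z - x (n + 1))) / 2 := by
        simp only [map_sub, map_smul, map_add, invOf_eq_inv, smul_eq_mul]; ring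
      rw [e1] at h
      have hε : 0 ≤ ε := by linarith
      rcases Nat.lt_or_ge n i with hlt | hge
      · obtain rfl : i = n + 1 := by omega
        have : (1 : ℝ) ≤ 2 ^ n := one_le_pow₀ (by norm_num)
        rw [pow_succ]
        nlinarith
      · have := ih (2 * ε) hi (by linarith) i hge
        rw [pow_succ]; linarith
  -- lower bound for convex combinations
  have low : ∀ n, ∀ y ∈ convexHull ℝ (x '' Iic n), ρ - 2 ^ n * e n ≤ ‖x (n + 1) - y‖ := by
    intro n y hy
    obtain ⟨g, hg1, hg2⟩ := exists_dual_vector'' ℝ (x (n + 1) - a n)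
    have hgle : ∀ w, g w ≤ ‖w‖ := fun w =>
      (le_abs_self _).trans ((g.le_opNorm w).trans (by nlinarith [norm_nonneg w]))
    have hh := half n g (x (n + 1)) (e n) (fun i => (hgle _).trans (hd _ _))
      (by change _ ≤ g _
          rw [hg2, norm_sub_rev]; exact he n)
    have hconv : Convex ℝ {w : B | g w ≤ g (x (n + 1)) - (ρ - 2 ^ n * e n)} :=
      convex_halfSpace_le g.toLinearMap.isLinear _
    have : y ∈ {w : B | g w ≤ g (x (n + 1)) - (ρ - 2 ^ n * e n)} := by
      refine convexHull_min ?_ hconv hy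
      rintro _ ⟨i, hi, rfl⟩
      have := hh i hi
      change _ ≤ g _ at this
      rw [map_sub] at this
      simp only [mem_ofPred_eq]; linarith
    refine le_trans ?_ (hgle _)
    rw [map_sub]
    simp only [mem_ofPred_eq] at this
    linarith
  let F : Set B := closure (⋃ n, convexHull ℝ (x '' Iic n))
  have hmono : Monotone fun n => convexHull ℝ (x '' Iic n) := fun m n hmn =>
    convexHull_mono (image_mono (Iic_subset_Iic.2 hmn))
  have hFconv : Convex ℝ F :=
    ((directed_of_isDirected_le hmono).convex_iUnion fun n => convex_convexHull ℝ _).closure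
  have hxF : ∀ n, x n ∈ F := fun n =>
    subset_closure (mem_iUnion.2 ⟨n, subset_convexHull ℝ _ ⟨n, mem_Iic.2 le_rfl, rfl⟩⟩)
  have hFsub : F ⊆ closure (convexHull ℝ (range x)) :=
    closure_mono (iUnion_subset fun n => convexHull_mono (image_subset_range _ _))
  have hFV : F ⊆ V := hFsub.trans
    (closure_minimal (convexHull_min (by rintro _ ⟨n, rfl⟩; exact hx n) hVconv) hVc)
  have hrb : Bornology.IsBounded (range x) := by
    rw [Metric.isBounded_iff]
    refine ⟨ρ, ?_⟩
    rintro _ ⟨i, rfl⟩ _ ⟨j, rfl⟩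
    rw [dist_eq_norm]; exact hd i j
  have hCb : Bornology.IsBounded (closure (convexHull ℝ (range x))) :=
    (isBounded_convexHull.2 hrb).closure
  have hFb : Bornology.IsBounded F := hCb.subset hFsub
  have hdiam : Metric.diam F ≤ ρ := by
    refine (Metric.diam_mono hFsub hCb).trans ?_
    rw [Metric.diam_closure, convexHull_diam]
    refine Metric.diam_le_of_forall_dist_le hρ.le ?_
    rintro _ ⟨i, rfl⟩ _ ⟨j, rfl⟩
    rw [dist_eq_norm]; exact hd i j
  have hnt : F.Nontrivial := by
    by_contra hs
    rw [not_nontrivial_iff] at hs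
    have hxx : ∀ n, x n = x 0 := fun n => hs (hxF n) (hxF 0)
    have haa : ∀ n, a n = x 0 := by
      intro n
      induction n with
      | zero => exact ha0
      | succ n ih => rw [ha, ih, hxx (n + 1)]; simp
    have : ρ ≤ 0 := by
      refine ge_of_tendsto' he0 fun n => ?_
      have := he n
      rw [haa, hxx (n + 1)] at this
      simpa using this
    linarith
  obtain ⟨y, hyF, hy⟩ := hVns F hFV isClosed_closure hFconv hnt
  have hbd : BddAbove (range fun w : F => ‖y - (w : B)‖) := by
    obtain ⟨C, hC⟩ := (Metric.isBounded_iff.1 hFb)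
    refine ⟨C, ?_⟩
    rintro _ ⟨w, rfl⟩
    change ‖y - (w : B)‖ ≤ C
    rw [← dist_eq_norm]; exact hC hyF w.2
  have hge : ρ ≤ supDist F y := by
    refine le_of_forall_pos_le_add fun η hη => ?_
    obtain ⟨p, hp, hpy⟩ := Metric.mem_closure_iff.1 hyF η hη
    obtain ⟨m, hm⟩ := mem_iUnion.1 hp
    have hlim' : Tendsto (fun n => ρ - 2 ^ n * e n) atTop (𝓝 (ρ - 0)) :=
      tendsto_const_nhds.sub hlim
    rw [sub_zero] at hlim'
    refine le_of_tendsto hlim' ?_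
    filter_upwards [eventually_ge_atTop m] with n hn
    have h1 := low n p (hmono hn hm)
    have h2 : ‖y - x (n + 1)‖ ≤ supDist F y := le_ciSup hbd ⟨x (n + 1), hxF _⟩
    have h3 : ‖x (n + 1) - p‖ ≤ ‖y - x (n + 1)‖ + ‖y - p‖ := by
      rw [show x (n + 1) - p = (y - p) - (y - x (n + 1)) by abel]
      linarith [norm_sub_le (y - p) (y - x (n + 1))]
    rw [dist_eq_norm] at hpy
    linarith
  linarith

/-- Stable (decomposable), midpoint convex, a.e.-closed sets of `V`-valued random elements. -/
structure Stab (V : Set B) (P : Measure Ω) (G : Set (Ω → B)) : Prop where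
  meas : ∀ x ∈ G, AEStronglyMeasurable x P
  mem : ∀ x ∈ G, ∀ ω, x ω ∈ V
  mid : ∀ x ∈ G, ∀ y ∈ G, (fun ω => midpoint ℝ (x ω) (y ω)) ∈ G
  pw : ∀ x ∈ G, ∀ y ∈ G, ∀ A : Set Ω, MeasurableSet A → (fun ω => if ω ∈ A then x ω else y ω) ∈ G
  lim : ∀ z : ℕ → Ω → B, (∀ n, z n ∈ G) → ∀ x : Ω → B, (∀ ω, x ω ∈ V) →
    (∀ᵐ ω ∂P, Tendsto (fun n => z n ω) atTop (𝓝 (x ω))) → x ∈ G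

theorem Stab.congr {V : Set B} {G : Set (Ω → B)} (hG : Stab V P G) {x y : Ω → B} (hx : x ∈ G)
    (hy : ∀ ω, y ω ∈ V) (h : x =ᵐ[P] y) : y ∈ G :=
  hG.lim (fun _ => x) (fun _ => hx) y hy (h.mono fun ω hω => by rw [hω]; exact tendsto_const_nhds)

/-- The set of all `V`-valued random elements. -/
def L0 (V : Set B) (P : Measure Ω) : Set (Ω → B) :=
  {x | AEStronglyMeasurable x P ∧ ∀ ω, x ω ∈ V}

theorem aesm_mid {x y : Ω → B} (hx : AEStronglyMeasurable x P) (hy : AEStronglyMeasurable y P) :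
    AEStronglyMeasurable (fun ω => midpoint ℝ (x ω) (y ω)) P := by
  simp_rw [midpoint_eq_smul_add]
  exact (hx.add hy).const_smul _

theorem aesm_pw {x y : Ω → B} (hx : AEStronglyMeasurable x P) (hy : AEStronglyMeasurable y P)
    {A : Set Ω} (hA : MeasurableSet A) :
    AEStronglyMeasurable (fun ω => if ω ∈ A then x ω else y ω) P := by
  have := (hx.restrict (s := A)).piecewise hA (hy.restrict (s := Aᶜ))
  exact this

theorem stab_L0 {V : Set B} (hV : Convex ℝ V) : Stab V P (L0 V P) where
  meas x hx := hx.1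
  mem x hx := hx.2
  mid x hx y hy := ⟨aesm_mid hx.1 hy.1, fun ω => hV.midpoint_mem (hx.2 ω) (hy.2 ω)⟩
  pw x hx y hy A hA := ⟨aesm_pw hx.1 hy.1 hA, fun ω => by
    dsimp only; split_ifs
    exacts [hx.2 ω, hy.2 ω]⟩
  lim z hz x hx h := ⟨aestronglyMeasurable_of_tendsto_ae atTop (fun n => (hz n).1) h, hx⟩

/-- Gluing lemma. -/
theorem Stab.glue {V : Set B} {G : Set (Ω → B)} (hG : Stab V P G) (h : ℕ → Ω → B)
    (hh : ∀ n, h n ∈ G) (D : ℕ → Ω → ℝ≥0∞) (hD : ∀ n, AEMeasurable (D n) P) (x : Ω → B)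
    (hx : ∀ ω, x ω ∈ V) (h1 : ∀ n, ∀ᵐ ω ∂P, ‖x ω - h n ω‖ₑ ≤ D n ω)
    (h2 : ∀ᵐ ω ∂P, ⨅ n, D n ω = 0) : x ∈ G := by
  let D' : ℕ → Ω → ℝ≥0∞ := fun n => (hD n).mk
  have hD'm : ∀ n, Measurable (D' n) := fun n => (hD n).measurable_mk
  have hDD : ∀ᵐ ω ∂P, ∀ n, D n ω = D' n ω := ae_all_iff.2 fun n => (hD n).ae_eq_mk
  let zE : ℕ → (Ω → B) × (Ω → ℝ≥0∞) := fun n => Nat.rec (h 0, D' 0)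
    (fun n p => (fun ω => if ω ∈ {ω | D' (n + 1) ω < p.2 ω} then h (n + 1) ω else p.1 ω,
      fun ω => min (p.2 ω) (D' (n + 1) ω))) n
  have hE : ∀ n, Measurable (zE n).2 := by
    intro n
    induction n with
    | zero => exact hD'm 0
    | succ n ih => exact ih.min (hD'm _)
  have hz : ∀ n, (zE n).1 ∈ G := by
    intro n
    induction n with
    | zero => exact hh 0
    | succ n ih =>
      have := hG.pw _ (hh (n + 1)) _ ih {ω | D' (n + 1) ω < (zE n).2 ω}
        (measurableSet_lt (hD'm (n + 1)) (hE n))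
      have e : (zE (n + 1)).1 = fun ω => if ω ∈ {ω | D' (n + 1) ω < (zE n).2 ω}
        then h (n + 1) ω else (zE n).1 ω := rfl
      rw [e]
      convert this
  have hEle : ∀ n ω, ∀ m ≤ n, (zE n).2 ω ≤ D' m ω := by
    intro n ω
    induction n with
    | zero => intro m hm; obtain rfl : m = 0 := by omega
              exact le_rfl
    | succ n ih =>
      intro m hm
      rcases Nat.lt_or_ge n m with hlt | hge
      · obtain rfl : m = n + 1 := by omega
        exact min_le_right _ _
      · exact (min_le_left _ _).trans (ih m hge)
  refine hG.lim (fun n => (zE n).1) hz x hx ?_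
  filter_upwards [ae_all_iff.2 h1, h2, hDD] with ω h1 h2 hDD
  have hb : ∀ n, ‖x ω - (zE n).1 ω‖ₑ ≤ (zE n).2 ω := by
    intro n
    induction n with
    | zero => exact (h1 0).trans (hDD 0).le
    | succ n ih =>
      change ‖x ω - (if D' (n + 1) ω < (zE n).2 ω then h (n + 1) ω else (zE n).1 ω)‖ₑ
        ≤ min ((zE n).2 ω) (D' (n + 1) ω)
      split_ifs with hlt
      · rw [min_eq_right hlt.le]; exact (h1 _).trans (hDD _).le
      · rw [min_eq_left (not_lt.1 hlt)]; exact ih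
  have hE0 : Tendsto (fun n => (zE n).2 ω) atTop (𝓝 0) := by
    rw [ENNReal.tendsto_atTop_zero]
    intro ε hε
    obtain ⟨m, hm⟩ := iInf_lt_iff.1 (h2.trans_lt hε)
    exact ⟨m, fun n hn => (hEle n ω m hn).trans ((hDD m).symm.trans_le hm.le)⟩
  rw [tendsto_iff_edist_tendsto_0]
  refine tendsto_of_tendsto_of_tendsto_of_le_of_le tendsto_const_nhds hE0 (fun _ => zero_le) ?_
  intro n
  change edist ((zE n).1 ω) (x ω) ≤ (zE n).2 ω
  rw [edist_comm, edist_eq_enorm_sub]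
  exact hb n

theorem exists_weak_lim {H : Type*} [NormedAddCommGroup H] [InnerProductSpace ℝ H]
    [CompleteSpace H] {ι : Type*} (𝒰 : Ultrafilter ι) (u : ι → H) (R : ℝ) (hR : ∀ i, ‖u i‖ ≤ R) :
    ∃ f : H, ∀ Λ : StrongDual ℝ H, Tendsto (fun i => Λ (u i)) 𝒰 (𝓝 (Λ f)) := by
  have hc := WeakDual.isCompact_closedBall (𝕜 := ℝ) (E := H) 0 R
  let v : ι → WeakDual ℝ H := fun i => StrongDual.toWeakDual (InnerProductSpace.toDual ℝ H (u i))
  have hv : ∀ i, v i ∈ (WeakDual.toStrongDual : WeakDual ℝ H → _) ⁻¹' Metric.closedBall (0 : StrongDual ℝ H) R := by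
    intro i
    have : ‖InnerProductSpace.toDual ℝ H (u i)‖ ≤ R := by simpa using hR i
    simpa [v] using this
  obtain ⟨g, _, hg⟩ := hc.ultrafilter_le_nhds (𝒰.map v) (by
    rw [Filter.le_principal_iff]
    exact Filter.Eventually.of_forall (f := (𝒰 : Filter ι)) hv)
  have hg' : Tendsto v 𝒰 (𝓝 g) := hg
  refine ⟨(InnerProductSpace.toDual ℝ H).symm (WeakDual.toStrongDual g), fun Λ => ?_⟩
  obtain ⟨w, rfl⟩ := (InnerProductSpace.toDual ℝ H).surjective Λ
  have h1 : Tendsto (fun i => v i w) 𝒰 (𝓝 (g w)) :=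
    ((WeakDual.eval_continuous w).tendsto g).comp hg'
  have e1 : ∀ i, v i w = InnerProductSpace.toDual ℝ H w (u i) := fun i => by
    rw [InnerProductSpace.toDual_apply_apply, real_inner_comm,
      ← InnerProductSpace.toDual_apply_apply (𝕜 := ℝ)]
    rfl
  have e2 : g w = InnerProductSpace.toDual ℝ H w
      ((InnerProductSpace.toDual ℝ H).symm (WeakDual.toStrongDual g)) := by
    rw [InnerProductSpace.toDual_apply_apply, real_inner_comm,
      InnerProductSpace.toDual_symm_apply]
    rfl
  rw [← e2]
  exact h1.congr e1

theorem mazur {E : Type*} [NormedAddCommGroup E] [NormedSpace ℝ E] {ι : Type*}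
    {𝒰 : Filter ι} [𝒰.NeBot] (H : Set E) (hH : ∀ x ∈ H, ∀ y ∈ H, midpoint ℝ x y ∈ H) (u : ι → E)
    (hu : ∀ᶠ i in 𝒰, u i ∈ H) (f : E)
    (hf : ∀ Λ : StrongDual ℝ E, Tendsto (fun i => Λ (u i)) 𝒰 (𝓝 (Λ f))) : f ∈ closure H := by
  have hcv : Convex ℝ (closure H) := by
    refine convex_of_mid isClosed_closure fun x hx y hy => ?_
    refine map_mem_closure₂ (f := fun x y => midpoint ℝ x y) ?_ hx hy hH
    simp_rw [midpoint_eq_smul_add]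
    fun_prop
  by_contra hn
  obtain ⟨Λ, c, h1, h2⟩ := geometric_hahn_banach_closed_point hcv isClosed_closure hn
  have : Λ f ≤ c := le_of_tendsto (hf Λ) (hu.mono fun i hi => (h1 _ (subset_closure hi)).le)
  linarith

theorem mazur_pi {E : Type*} [NormedAddCommGroup E] [NormedSpace ℝ E] {ι : Type*} {J : Type*}
    [Fintype J] {𝒰 : Filter ι} [𝒰.NeBot] (H : Set (J → E))
    (hH : ∀ x ∈ H, ∀ y ∈ H, midpoint ℝ x y ∈ H) (u : ι → J → E)
    (hu : ∀ᶠ i in 𝒰, u i ∈ H) (f : J → E)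
    (hf : ∀ j, ∀ Λ : StrongDual ℝ E, Tendsto (fun i => Λ (u i j)) 𝒰 (𝓝 (Λ (f j)))) :
    f ∈ closure H := by
  refine mazur H hH u hu f fun Λ => ?_
  have e : ∀ v : J → E, Λ v = ∑ j, (Λ.comp (ContinuousLinearMap.single ℝ (fun _ : J => E) j)) (v j) := by
    intro v
    conv_lhs => rw [← Finset.univ_sum_single v, map_sum]
    rfl
  simp_rw [e]
  exact tendsto_finsetSum _ fun j _ => hf j _

/-- `φ ∘ h` as an element of `L²`. -/
def lp (P : Measure Ω) (φ : StrongDual ℝ B) (h : Ω → B) : Lp ℝ 2 P :=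
  if hm : MemLp (fun ω => φ (h ω)) 2 P then hm.toLp _ else 0

theorem memLp_comp {V : Set B} {C : ℝ} (hC : ∀ x ∈ V, ‖x‖ ≤ C) (φ : StrongDual ℝ B) {h : Ω → B}
    (hh : h ∈ L0 V P) : MemLp (fun ω => φ (h ω)) 2 P := by
  refine MemLp.of_bound (φ.continuous.comp_aestronglyMeasurable hh.1) (‖φ‖ * C)
    (Eventually.of_forall fun ω => (φ.le_opNorm _).trans ?_)
  exact mul_le_mul_of_nonneg_left (hC _ (hh.2 ω)) (norm_nonneg _)

theorem lp_coe {V : Set B} {C : ℝ} (hC : ∀ x ∈ V, ‖x‖ ≤ C) (φ : StrongDual ℝ B) {h : Ω → B}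
    (hh : h ∈ L0 V P) : lp P φ h =ᵐ[P] fun ω => φ (h ω) := by
  rw [lp, dif_pos (memLp_comp hC φ hh)]
  exact MemLp.coeFn_toLp _

theorem lp_norm {V : Set B} {C : ℝ} (hC0 : 0 ≤ C) (hC : ∀ x ∈ V, ‖x‖ ≤ C) (φ : StrongDual ℝ B)
    {h : Ω → B} (hh : h ∈ L0 V P) : ‖lp P φ h‖ ≤ ‖φ‖ * C := by
  have := Lp.norm_le_of_ae_bound (f := lp P φ h) (C := ‖φ‖ * C) (by positivity) (by
    filter_upwards [lp_coe hC φ hh] with ω hω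
    rw [hω]
    exact (φ.le_opNorm _).trans (mul_le_mul_of_nonneg_left (hC _ (hh.2 ω)) (norm_nonneg _)))
  have h1 : measureUnivNNReal P = 1 := by simp [measureUnivNNReal]
  simpa [h1] using this

theorem lp_mid {V : Set B} (hV : Convex ℝ V) {C : ℝ} (hC : ∀ x ∈ V, ‖x‖ ≤ C)
    (φ : StrongDual ℝ B) {h k : Ω → B} (hh : h ∈ L0 V P) (hk : k ∈ L0 V P) :
    lp P φ (fun ω => midpoint ℝ (h ω) (k ω)) = midpoint ℝ (lp P φ h) (lp P φ k) := by
  rw [midpoint_eq_smul_add]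
  apply Lp.ext
  have hm := (stab_L0 (P := P) hV).mid h hh k hk
  filter_upwards [lp_coe hC φ hh, lp_coe hC φ hk, lp_coe hC φ hm,
    Lp.coeFn_smul (⅟2 : ℝ) (lp P φ h + lp P φ k), Lp.coeFn_add (lp P φ h) (lp P φ k)]
    with ω h1 h2 h3 h4 h5
  rw [h3, h4, Pi.smul_apply, h5, Pi.add_apply, h1, h2, midpoint_eq_smul_add, map_smul, map_add]

/-- Convergence in `L²` at a geometric rate implies a.e. convergence. -/
theorem lp_tendsto (f : Lp ℝ 2 P) (g : ℕ → Lp ℝ 2 P) (N : ℕ)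
    (h : ∀ n ≥ N, ‖g n - f‖ ≤ (1 / 2) ^ n) :
    ∀ᵐ ω ∂P, Tendsto (fun n => g n ω) atTop (𝓝 (f ω)) := by
  have hintg : ∀ n ≥ N, ∫⁻ ω, ‖g n ω - f ω‖ₑ ∂P ≤ ENNReal.ofReal ((1 / 2) ^ n) := by
    intro n hn
    have h1 : eLpNorm (g n - f : Lp ℝ 2 P) 1 P ≤ eLpNorm (g n - f : Lp ℝ 2 P) 2 P :=
      eLpNorm_le_eLpNorm_of_exponent_le (by norm_num) (Lp.aestronglyMeasurable _)
    rw [eLpNorm_one_eq_lintegral_enorm, ← Lp.enorm_def] at h1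
    have h2 : ∫⁻ ω, ‖g n ω - f ω‖ₑ ∂P = ∫⁻ ω, ‖(g n - f : Lp ℝ 2 P) ω‖ₑ ∂P := by
      refine lintegral_congr_ae ?_
      filter_upwards [Lp.coeFn_sub (g n) f] with ω hω
      rw [hω]; rfl
    rw [h2]
    refine h1.trans ?_
    rw [← ofReal_norm]
    exact ENNReal.ofReal_le_ofReal (h n hn)
  have := ae_tendsto_zero (P := P) (fun n ω => ‖g (n + N) ω - f ω‖ₑ)
    (fun n => ((Lp.aestronglyMeasurable _).sub (Lp.aestronglyMeasurable _)).enorm) (by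
      refine ne_top_of_le_ne_top ?_ (ENNReal.tsum_le_tsum fun n => hintg (n + N) (by omega))
      rw [← ENNReal.ofReal_tsum_of_nonneg (fun n => by positivity)]
      · exact ENNReal.ofReal_ne_top
      · exact (summable_nat_add_iff N).2 summable_geometric_two)
  filter_upwards [this] with ω hω
  rw [← tendsto_add_atTop_iff_nat N, tendsto_iff_edist_tendsto_0]
  simpa only [edist_eq_enorm_sub] using hω

/-- A countable norming family for a random element. -/
theorem norming {w : Ω → B} (hw : AEStronglyMeasurable w P) :
    ∃ φ : ℕ → StrongDual ℝ B, (∀ n, ‖φ n‖ ≤ 1) ∧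
      ∀ᵐ ω ∂P, ∀ c : ℝ, (∀ n, |φ n (w ω)| ≤ c) → ‖w ω‖ ≤ c := by
  obtain ⟨t, ht, hwt⟩ := hw.isSeparable_ae_range
  obtain ⟨d, hd, hdt⟩ := ht
  have hdne : ∃ u : ℕ → B, insert 0 d = range u := (hd.insert 0).exists_eq_range (by simp)
  obtain ⟨u, hu⟩ := hdne
  choose φ h1 h2 using fun n => exists_dual_vector'' ℝ (u n)
  refine ⟨φ, h1, ?_⟩
  filter_upwards [hwt] with ω hω c hc
  refine le_of_forall_pos_le_add fun ε hε => ?_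
  have : w ω ∈ closure (range u) := by
    rw [← hu]; exact closure_mono (subset_insert _ _) (hdt hω)
  obtain ⟨_, ⟨n, rfl⟩, hn⟩ := Metric.mem_closure_iff.1 this (ε / 2) (by linarith)
  rw [dist_eq_norm] at hn
  have e1 : ‖u n‖ = φ n (u n) := (h2 n).symm
  have e2 : φ n (w ω - u n) = φ n (w ω) - φ n (u n) := map_sub _ _ _
  have e3 : |φ n (w ω - u n)| ≤ ‖w ω - u n‖ :=
    ((φ n).le_opNorm _).trans (by nlinarith [norm_nonneg (w ω - u n), h1 n])
  have e4 := hc n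
  have e5 : ‖w ω‖ ≤ ‖w ω - u n‖ + ‖u n‖ := by
    simpa using norm_add_le (w ω - u n) (u n)
  rw [abs_le] at e3 e4
  linarith

theorem reconstruct {V : Set B} (hVc : Convex ℝ V) (hV : WeaklyCompact V) {G : Set (Ω → B)}
    (hG : Stab V P G) (f : StrongDual ℝ B → Lp ℝ 2 P)
    (happ : ∀ (F : Finset (StrongDual ℝ B)) (ε : ℝ), 0 < ε →
      ∃ h ∈ G, ∀ φ ∈ F, ‖lp P φ h - f φ‖ ≤ ε) :
    ∃ x ∈ G, ∀ ψ : StrongDual ℝ B, ‖ψ‖ ≤ 1 → ∀ᵐ ω ∂P, ψ (x ω) = f ψ ω := by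
  obtain ⟨C, hC0, hC⟩ := hV.bounded
  have hGL : ∀ h ∈ G, h ∈ L0 V P := fun h hh => ⟨hG.meas h hh, hG.mem h hh⟩
  let Dl := {φ : StrongDual ℝ B // ‖φ‖ ≤ 1}
  have : Nonempty Dl := ⟨⟨0, by simp⟩⟩
  -- norming functionals
  have hN : ∀ h k : G, ∃ φ : ℕ → Dl, ∀ᵐ ω ∂P, ∀ c : ℝ,
      (∀ n, |(φ n).1 (h.1 ω - k.1 ω)| ≤ c) → ‖h.1 ω - k.1 ω‖ ≤ c := by
    intro h k
    obtain ⟨φ, h1, h2⟩ := norming ((hG.meas _ h.2).sub (hG.meas _ k.2))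
    exact ⟨fun n => ⟨φ n, h1 n⟩, h2⟩
  choose N hN using hN
  have hE : ∀ h : G, ∃ φ : ℕ → Dl, ∀ ψ : Dl, ∀ᵐ ω ∂P, ∀ c : ℝ,
      (∀ n, |f (φ n).1 ω - (φ n).1 (h.1 ω)| ≤ c) → |f ψ.1 ω - ψ.1 (h.1 ω)| ≤ c := by
    intro h
    exact ess_gen (P := P) (fun (ψ : Dl) ω => |f ψ.1 ω - ψ.1 (h.1 ω)|) (fun ψ =>
      (((Lp.aestronglyMeasurable _).sub
        (ψ.1.continuous.comp_aestronglyMeasurable (hG.meas _ h.2))).norm).aemeasurable)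
  choose E hE using hE
  have hA : ∀ (F : Finset (G ⊕ Dl)) (n : ℕ), ∃ h : G, ∀ φ : Dl, Sum.inr φ ∈ F →
      ‖lp P φ.1 h.1 - f φ.1‖ ≤ (1 / 2) ^ n := by
    intro F n
    obtain ⟨h, hh, h1⟩ := happ (F.biUnion fun a => Sum.elim (fun _ => ∅) (fun φ => {φ.1}) a)
      ((1 / 2) ^ n) (by positivity)
    refine ⟨⟨h, hh⟩, fun φ hφ => h1 _ ?_⟩
    exact Finset.mem_biUnion.2 ⟨_, hφ, by simp⟩
  choose apx hapx using hA
  let c2 : G ⊕ Dl → G ⊕ Dl → Set (G ⊕ Dl) := fun a b =>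
    Sum.elim (fun h => Sum.elim (fun k : G => insert
      (Sum.inl ⟨fun ω => midpoint ℝ (h.1 ω) (k.1 ω), hG.mid _ h.2 _ k.2⟩)
      (range (fun n => Sum.inr (N h k n)) ∪ range (fun n => Sum.inr (E h n)))) (fun _ => ∅) b)
      (fun _ => ∅) a
  have hc2 : ∀ a b, (c2 a b).Countable := by
    rintro (h | φ) (k | ψ)
    · exact ((countable_range _).union (countable_range _)).insert _
    all_goals exact countable_empty
  obtain ⟨S, hSc, hS⟩ := exists_closed (X := G ⊕ Dl) (fun F =>
    (⋃ a ∈ F, ⋃ b ∈ F, c2 a b) ∪ range fun n => Sum.inl (apx F n)) (fun F =>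
      (F.countable_toSet.biUnion fun a _ => F.countable_toSet.biUnion fun b _ => hc2 a b).union
        (countable_range _))
  have hS2 : ∀ a ∈ S, ∀ b ∈ S, c2 a b ⊆ S := by
    intro a ha b hb t ht
    refine hS {a, b} ?_ (Or.inl ?_)
    · intro q hq
      simp only [Finset.coe_insert, Finset.coe_singleton, mem_insert_iff, mem_singleton_iff] at hq
      rcases hq with rfl | rfl <;> assumption
    · simp only [mem_iUnion]
      exact ⟨a, by simp, b, by simp, ht⟩
  have hSA : ∀ F : Finset (G ⊕ Dl), (F : Set (G ⊕ Dl)) ⊆ S → ∀ n, Sum.inl (apx F n) ∈ S :=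
    fun F hF n => hS F hF (Or.inr ⟨n, rfl⟩)
  have hHc : (Sum.inl ⁻¹' S : Set G).Countable := hSc.preimage Sum.inl_injective
  have hPc : (Sum.inr ⁻¹' S : Set Dl).Countable := hSc.preimage Sum.inr_injective
  have hHne : (Sum.inl ⁻¹' S : Set G).Nonempty := ⟨apx ∅ 0, hSA ∅ (by simp) 0⟩
  obtain ⟨hs, hhs⟩ := hHc.exists_eq_range hHne
  have hsS : ∀ k, Sum.inl (hs k) ∈ S := fun k => by
    change hs k ∈ (Sum.inl ⁻¹' S : Set G)
    rw [hhs]; exact ⟨k, rfl⟩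
  have hPne : (Sum.inr ⁻¹' S : Set Dl).Nonempty :=
    ⟨N (hs 0) (hs 0) 0, hS2 _ (hsS 0) _ (hsS 0) (Or.inr (Or.inl ⟨0, rfl⟩))⟩
  obtain ⟨φ, hφ⟩ := hPc.exists_eq_range hPne
  have hφS : ∀ k, Sum.inr (φ k) ∈ S := fun k => by
    change φ k ∈ (Sum.inr ⁻¹' S : Set Dl)
    rw [hφ]; exact ⟨k, rfl⟩
  have hNφ : ∀ k l n, ∃ m, φ m = N (hs k) (hs l) n := fun k l n => by
    have : N (hs k) (hs l) n ∈ (Sum.inr ⁻¹' S : Set Dl) :=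
      hS2 _ (hsS k) _ (hsS l) (Or.inr (Or.inl ⟨n, rfl⟩))
    rw [hφ] at this; exact this
  have hEφ : ∀ k n, ∃ m, φ m = E (hs k) n := fun k n => by
    have : E (hs k) n ∈ (Sum.inr ⁻¹' S : Set Dl) :=
      hS2 _ (hsS k) _ (hsS k) (Or.inr (Or.inr ⟨n, rfl⟩))
    rw [hφ] at this; exact this
  have hmid : ∀ k l, ∃ j, (hs j).1 = fun ω => midpoint ℝ ((hs k).1 ω) ((hs l).1 ω) := fun k l => by
    have : (⟨fun ω => midpoint ℝ ((hs k).1 ω) ((hs l).1 ω), hG.mid _ (hs k).2 _ (hs l).2⟩ : G)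
      ∈ (Sum.inl ⁻¹' S : Set G) := hS2 _ (hsS k) _ (hsS l) (Or.inl rfl)
    rw [hhs] at this
    obtain ⟨j, hj⟩ := this
    exact ⟨j, by rw [hj]⟩
  let FF : ℕ → Finset (G ⊕ Dl) := fun n => (Finset.range n).image fun m => Sum.inr (φ m)
  have hFF : ∀ n, (FF n : Set (G ⊕ Dl)) ⊆ S := by
    intro n a ha
    simp only [FF, Finset.coe_image, mem_image] at ha
    obtain ⟨m, _, rfl⟩ := ha
    exact hφS m
  let y : ℕ → G := fun n => apx (FF n) n
  have hyh : ∀ n, ∃ k, hs k = y n := fun n => by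
    have : y n ∈ (Sum.inl ⁻¹' S : Set G) := hSA _ (hFF n) n
    rw [hhs] at this; exact this
  have hyconv : ∀ᵐ ω ∂P, ∀ m, Tendsto (fun n => (φ m).1 ((y n).1 ω)) atTop (𝓝 (f (φ m).1 ω)) := by
    rw [ae_all_iff]
    intro m
    have h1 := lp_tendsto (f (φ m).1) (fun n => lp P (φ m).1 (y n).1) (m + 1) (fun n hn =>
      hapx (FF n) n (φ m) (Finset.mem_image.2 ⟨m, Finset.mem_range.2 (by omega), rfl⟩))
    have h2 : ∀ᵐ ω ∂P, ∀ n, lp P (φ m).1 (y n).1 ω = (φ m).1 ((y n).1 ω) :=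
      ae_all_iff.2 fun n => lp_coe hC (φ m).1 (hGL _ (y n).2)
    filter_upwards [h1, h2] with ω h1 h2
    simpa only [h2] using h1
  -- the weak cluster points
  have hx : ∀ ω, ∃ x ∈ V, ∀ ψ : StrongDual ℝ B,
      Tendsto (fun n => ψ ((y n).1 ω)) (hyperfilter ℕ) (𝓝 (ψ x)) := by
    intro ω
    obtain ⟨w, ⟨x, hxV, rfl⟩, hw⟩ := IsCompact.ultrafilter_le_nhds hV
      ((hyperfilter ℕ).map fun n => toWeakSpace ℝ B ((y n).1 ω)) (by
        rw [Filter.le_principal_iff]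
        exact Filter.Eventually.of_forall (f := (hyperfilter ℕ : Filter ℕ))
          (fun n => mem_image_of_mem _ (hG.mem _ (y n).2 ω)))
    refine ⟨x, hxV, fun ψ => ?_⟩
    have hw' : Tendsto (fun n => toWeakSpace ℝ B ((y n).1 ω)) (hyperfilter ℕ)
      (𝓝 (toWeakSpace ℝ B x)) := hw
    have := ((continuous_dual_weak ψ).tendsto _).comp hw'
    simpa [Function.comp_def] using this
  choose x hxV hx using hx
  have hxcl : ∀ ω, x ω ∈ closure (range fun k => (hs k).1 ω) := by
    intro ω
    refine mazur _ ?_ (fun n => (y n).1 ω) (Eventually.of_forall fun n => ?_) (x ω) (hx ω)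
    · rintro _ ⟨k, rfl⟩ _ ⟨l, rfl⟩
      obtain ⟨j, hj⟩ := hmid k l
      exact ⟨j, by simp only [hj]⟩
    · obtain ⟨k, hk⟩ := hyh n
      exact ⟨k, by simp only [hk]⟩
  have hxf : ∀ᵐ ω ∂P, ∀ m, f (φ m).1 ω = (φ m).1 (x ω) := by
    filter_upwards [hyconv] with ω hω m
    exact tendsto_nhds_unique ((hω m).mono_left Nat.hyperfilter_le_atTop) (hx ω _)
  have hle : ∀ (ψ : Dl) (w : B), |ψ.1 w| ≤ ‖w‖ := fun ψ w =>
    (ψ.1.le_opNorm w).trans (by nlinarith [norm_nonneg w, ψ.2])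
  have hnear : ∀ ω, ∀ ε > 0, ∃ k, ‖x ω - (hs k).1 ω‖ < ε := by
    intro ω ε hε
    obtain ⟨_, ⟨k, rfl⟩, hk⟩ := Metric.mem_closure_iff.1 (hxcl ω) ε hε
    exact ⟨k, by rwa [dist_eq_norm] at hk⟩
  have hnorm : ∀ᵐ ω ∂P, ∀ k, ∀ c : ℝ, (∀ m, |(φ m).1 (x ω - (hs k).1 ω)| ≤ c) →
      ‖x ω - (hs k).1 ω‖ ≤ c := by
    have h0 : ∀ᵐ ω ∂P, ∀ l k, ∀ c : ℝ,
      (∀ n, |(N (hs l) (hs k) n).1 ((hs l).1 ω - (hs k).1 ω)| ≤ c) →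
        ‖(hs l).1 ω - (hs k).1 ω‖ ≤ c :=
      ae_all_iff.2 fun l => ae_all_iff.2 fun k => hN _ _
    filter_upwards [h0] with ω h0 k c hc
    refine le_of_forall_pos_le_add fun ε hε => ?_
    obtain ⟨l, hl⟩ := hnear ω (ε / 2) (by linarith)
    have h1 := h0 l k (c + ε / 2) (fun n => by
      obtain ⟨m, hm⟩ := hNφ l k n
      rw [← hm]
      have e : (hs l).1 ω - (hs k).1 ω = (x ω - (hs k).1 ω) - (x ω - (hs l).1 ω) := by abel
      rw [e, map_sub]
      have a1 := hc m
      have a2 := hle (φ m) (x ω - (hs l).1 ω)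
      have a3 := abs_sub ((φ m).1 (x ω - (hs k).1 ω)) ((φ m).1 (x ω - (hs l).1 ω))
      linarith)
    have h2 : ‖x ω - (hs k).1 ω‖ ≤ ‖x ω - (hs l).1 ω‖ + ‖(hs l).1 ω - (hs k).1 ω‖ :=
      norm_sub_le_norm_sub_add_norm_sub _ _ _
    linarith
  have hxG : x ∈ G := by
    refine hG.glue (fun k => (hs k).1) (fun k => (hs k).2)
      (fun k ω => ⨆ m, ‖f (φ m).1 ω - (φ m).1 ((hs k).1 ω)‖ₑ) (fun k => ?_) x hxV (fun k => ?_) ?_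
    · exact AEMeasurable.iSup fun m => ((Lp.aestronglyMeasurable _).sub
        ((φ m).1.continuous.comp_aestronglyMeasurable (hG.meas _ (hs k).2))).enorm
    · filter_upwards [hxf, hnorm] with ω hxf hnorm
      simp_rw [hxf, ← map_sub]
      by_cases ht : (⨆ m, ‖(φ m).1 (x ω - (hs k).1 ω)‖ₑ) = ∞
      · rw [ht]; exact le_top
      rw [← ofReal_norm, ← ENNReal.ofReal_toReal ht]
      refine ENNReal.ofReal_le_ofReal (hnorm k _ fun m => ?_)
      have := ENNReal.toReal_mono ht (le_iSup (fun m => ‖(φ m).1 (x ω - (hs k).1 ω)‖ₑ) m)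
      simpa using this
    · filter_upwards [hxf] with ω hxf
      simp_rw [hxf, ← map_sub]
      refine le_antisymm (le_of_forall_gt_imp_ge_of_dense fun ε hε => ?_) zero_le
      obtain ⟨δ, hδ0, hδ⟩ := ENNReal.lt_iff_exists_real_btwn.1 hε
      have hδp : 0 < δ := by simpa using hδ.1
      obtain ⟨k, hk⟩ := hnear ω δ hδp
      refine (iInf_le _ k).trans (iSup_le fun m => ?_)
      rw [← ofReal_norm]
      refine (ENNReal.ofReal_le_ofReal ?_).trans hδ.2.le
      exact (hle _ _).trans hk.le
  refine ⟨x, hxG, fun ψ hψ => ?_⟩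
  have h0 : ∀ᵐ ω ∂P, ∀ k, ∀ c : ℝ,
      (∀ n, |f (E (hs k) n).1 ω - (E (hs k) n).1 ((hs k).1 ω)| ≤ c) →
        |f ψ ω - ψ ((hs k).1 ω)| ≤ c := ae_all_iff.2 fun k => hE (hs k) ⟨ψ, hψ⟩
  filter_upwards [h0, hxf] with ω h0 hxf
  have h1 : |ψ (x ω) - f ψ ω| ≤ 0 := by
    refine le_of_forall_pos_le_add fun ε hε => ?_
    obtain ⟨k, hk⟩ := hnear ω (ε / 2) (by linarith)
    have a1 := h0 k (ε / 2) (fun n => by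
      obtain ⟨m, hm⟩ := hEφ k n
      rw [← hm, hxf, ← map_sub]
      exact (hle _ _).trans hk.le)
    have a2 := (hle ⟨ψ, hψ⟩ (x ω - (hs k).1 ω)).trans hk.le
    simp only [map_sub] at a2
    rw [abs_le] at *
    constructor <;> linarith
  have := abs_nonpos_iff.1 h1
  linarith

theorem compactC {V : Set B} (hVc : Convex ℝ V) (hV : WeaklyCompact V) {ι : Type*} [Nonempty ι]
    (G : ι → Set (Ω → B)) (hG : ∀ i, Stab V P (G i)) (hne : ∀ i, (G i).Nonempty)
    (hdir : ∀ i j, ∃ k, G k ⊆ G i ∧ G k ⊆ G j) : (⋂ i, G i).Nonempty := by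
  obtain ⟨C, hC0, hC⟩ := hV.bounded
  have hGL : ∀ i, ∀ h ∈ G i, h ∈ L0 V P := fun i h hh => ⟨(hG i).meas h hh, (hG i).mem h hh⟩
  choose y hy using hne
  have hNB : (⨅ i, 𝓟 {k | G k ⊆ G i}).NeBot := by
    refine iInf_neBot_of_directed' ?_ fun i => principal_neBot_iff.2 ⟨i, Subset.rfl⟩
    intro i j
    obtain ⟨k, h1, h2⟩ := hdir i j
    exact ⟨k, principal_mono.2 fun l hl => hl.trans h1, principal_mono.2 fun l hl => hl.trans h2⟩
  obtain ⟨𝒰, h𝒰⟩ := Ultrafilter.exists_le (⨅ i, 𝓟 {k | G k ⊆ G i})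
  have h𝒰' : ∀ i, ∀ᶠ k in (𝒰 : Filter ι), G k ⊆ G i := fun i =>
    h𝒰 (iInf_le (fun i => 𝓟 {k | G k ⊆ G i}) i (mem_principal_self _))
  choose f hf using fun φ : StrongDual ℝ B => exists_weak_lim 𝒰 (fun i => lp P φ (y i)) (‖φ‖ * C)
    (fun i => lp_norm hC0 hC φ (hGL i _ (hy i)))
  have hx : ∀ i, ∃ x ∈ G i, ∀ ψ : StrongDual ℝ B, ‖ψ‖ ≤ 1 → ∀ᵐ ω ∂P, ψ (x ω) = f ψ ω := by
    intro i
    refine reconstruct hVc hV (hG i) f fun F ε hε => ?_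
    have := mazur_pi (𝒰 := (𝒰 : Filter ι)) (J := F)
      ((fun (h : Ω → B) (φ : F) => lp P φ.1 h) '' G i) ?_ (fun k φ => lp P φ.1 (y k))
      ((h𝒰' i).mono fun k hk => mem_image_of_mem _ (hk (hy k))) (fun φ => f φ.1)
      (fun φ Λ => hf φ.1 Λ)
    · obtain ⟨_, ⟨h, hh, rfl⟩, hd⟩ := Metric.mem_closure_iff.1 this ε hε
      refine ⟨h, hh, fun φ hφ => ?_⟩
      have := (dist_le_pi_dist _ _ (⟨φ, hφ⟩ : F)).trans hd.le
      rwa [dist_comm, dist_eq_norm] at this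
    · rintro _ ⟨h, hh, rfl⟩ _ ⟨k, hk, rfl⟩
      refine ⟨_, (hG i).mid h hh k hk, ?_⟩
      ext1 φ
      dsimp only
      rw [lp_mid hVc hC φ.1 (hGL i h hh) (hGL i k hk), midpoint_eq_smul_add, midpoint_eq_smul_add]
      rfl
  choose x hxG hx using hx
  let i0 : ι := Classical.arbitrary ι
  refine ⟨x i0, mem_iInter.2 fun i => ?_⟩
  refine (hG i).congr (hxG i) ((hG i0).mem _ (hxG i0)) ?_
  obtain ⟨φ, h1, h2⟩ := norming (((hG i).meas _ (hxG i)).sub ((hG i0).meas _ (hxG i0)))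
  filter_upwards [h2, ae_all_iff.2 fun n => hx i (φ n) (h1 n),
    ae_all_iff.2 fun n => hx i0 (φ n) (h1 n)] with ω h2 h3 h4
  have := h2 0 (fun n => by simp [h3 n, h4 n])
  simpa [sub_eq_zero] using this

theorem ess_sup_exists {I : Type*} [Nonempty I] (g : I → Ω → ℝ) (hg : ∀ i, AEMeasurable (g i) P)
    (C : ℝ) (hC : ∀ i ω, |g i ω| ≤ C) :
    ∃ (D : Ω → ℝ) (k : ℕ → I), AEMeasurable D P ∧ (∀ ω, |D ω| ≤ C) ∧
      (∀ ω, D ω = ⨆ n, g (k n) ω) ∧ (∀ i, ∀ᵐ ω ∂P, g i ω ≤ D ω) ∧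
      (∀ D' : Ω → ℝ, (∀ i, ∀ᵐ ω ∂P, g i ω ≤ D' ω) → ∀ᵐ ω ∂P, D ω ≤ D' ω) := by
  obtain ⟨k, hk⟩ := ess_bdd g hg C hC
  have hbd : ∀ ω, BddAbove (range fun n => g (k n) ω) := fun ω =>
    ⟨C, by rintro _ ⟨n, rfl⟩; exact (abs_le.1 (hC _ _)).2⟩
  refine ⟨fun ω => ⨆ n, g (k n) ω, k, AEMeasurable.iSup fun n => hg _, fun ω => ?_, fun _ => rfl,
    hk, fun D' hD' => ?_⟩
  · rw [abs_le]
    exact ⟨(abs_le.1 (hC (k 0) ω)).1.trans (le_ciSup (hbd ω) 0),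
      ciSup_le fun n => (abs_le.1 (hC _ _)).2⟩
  · filter_upwards [ae_all_iff.2 fun n => hD' (k n)] with ω hω
    exact ciSup_le hω

/-- Pointwise application of a random operator to a random element. -/
def ap (s : Ω → B → B) (x : Ω → B) : Ω → B := fun ω => s ω (x ω)

/-- A commutative semigroup of random nonexpansive operators. -/
structure Core (V : Set B) (P : Measure Ω) (𝒮 : Set (Ω → B → B)) : Prop where
  maps : ∀ T ∈ 𝒮, ∀ ω : Ω, Set.MapsTo (T ω) V V
  meas : ∀ T ∈ 𝒮, ∀ x ∈ L0 V P, AEStronglyMeasurable (ap T x) P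
  nonexp : ∀ T ∈ 𝒮, ∀ ω : Ω, ∀ x ∈ V, ∀ y ∈ V, ‖T ω x - T ω y‖ ≤ ‖x - y‖
  comm : ∀ T ∈ 𝒮, ∀ S ∈ 𝒮, ∀ ω : Ω, ∀ x ∈ V, T ω (S ω x) = S ω (T ω x)
  one : (fun _ x => x) ∈ 𝒮
  mul : ∀ T ∈ 𝒮, ∀ S ∈ 𝒮, (fun ω x => T ω (S ω x)) ∈ 𝒮

theorem ap_meas {V : Set B} (hV : V.Nonempty) (hVc : Convex ℝ V) (T : Ω → B → B)
    (hmaps : ∀ ω : Ω, Set.MapsTo (T ω) V V)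
    (hmeas : ∀ x ∈ V, AEStronglyMeasurable (fun ω => T ω x) P)
    (hnonexp : ∀ ω : Ω, ∀ x ∈ V, ∀ y ∈ V, ‖T ω x - T ω y‖ ≤ ‖x - y‖) (x : Ω → B)
    (hx : x ∈ L0 V P) : AEStronglyMeasurable (ap T x) P := by
  obtain ⟨t, ht, hxt⟩ := hx.1.isSeparable_ae_range
  obtain ⟨d, hdt, hdc, hd⟩ := (ht.mono (inter_subset_left (t := V))).exists_countable_dense_subset
  obtain ⟨v, hv⟩ := hV
  obtain ⟨b, hb⟩ := (hdc.insert v).exists_eq_range ⟨v, mem_insert _ _⟩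
  have hbV : ∀ n, b n ∈ V := fun n => by
    have : b n ∈ insert v d := hb ▸ mem_range_self n
    rcases this with h | h
    · rw [h]; exact hv
    · exact (hdt h).2
  refine ((stab_L0 hVc).glue (fun n ω => T ω (b n))
    (fun n => ⟨hmeas _ (hbV n), fun ω => hmaps ω (hbV n)⟩) (fun n ω => ‖x ω - b n‖ₑ)
    (fun n => (hx.1.sub aestronglyMeasurable_const).enorm) (ap T x) (fun ω => hmaps ω (hx.2 ω))
    (fun n => Eventually.of_forall fun ω => ?_) ?_).1
  · rw [← ofReal_norm, ← ofReal_norm]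
    exact ENNReal.ofReal_le_ofReal (hnonexp ω _ (hx.2 ω) _ (hbV n))
  · filter_upwards [hxt] with ω hω
    have hcl : x ω ∈ closure (range b) := by
      rw [← hb]; exact closure_mono (subset_insert _ _) (hd ⟨hω, hx.2 ω⟩)
    refine le_antisymm (le_of_forall_gt_imp_ge_of_dense fun ε hε => ?_) zero_le
    obtain ⟨_, ⟨k, rfl⟩, hk⟩ := EMetric.mem_closure_iff.1 hcl ε hε
    rw [edist_eq_enorm_sub] at hk
    exact (iInf_le _ k).trans hk.le

/-- Minimal invariant stable sets. -/
structure MinK (V : Set B) (P : Measure Ω) (𝒮 : Set (Ω → B → B)) (K : Set (Ω → B)) : Prop where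
  stab : Stab V P K
  ne : K.Nonempty
  inv : ∀ s ∈ 𝒮, ∀ x ∈ K, ap s x ∈ K
  min : ∀ L, L ⊆ K → Stab V P L → L.Nonempty → (∀ s ∈ 𝒮, ∀ x ∈ L, ap s x ∈ L) → K ⊆ L

theorem exists_minK {V : Set B} (hVne : V.Nonempty) (hVc : Convex ℝ V) (hV : WeaklyCompact V)
    {𝒮 : Set (Ω → B → B)} (hS : Core V P 𝒮) : ∃ K, MinK V P 𝒮 K := by
  obtain ⟨K, hK⟩ := zorn_superset {K : Set (Ω → B) | Stab V P K ∧ K.Nonempty ∧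
    ∀ s ∈ 𝒮, ∀ x ∈ K, ap s x ∈ K} (by
      intro c hc hch
      rcases c.eq_empty_or_nonempty with rfl | hne
      · obtain ⟨v, hv⟩ := hVne
        exact ⟨L0 V P, ⟨stab_L0 hVc, ⟨fun _ => v, aestronglyMeasurable_const, fun _ => hv⟩,
          fun s hs x hx => ⟨hS.meas s hs x hx, fun ω => hS.maps s hs ω (hx.2 ω)⟩⟩, by simp⟩
      · have : Nonempty c := hne.to_subtype
        obtain ⟨L₀, hL₀⟩ := hne
        refine ⟨⋂ i : c, i.1, ⟨?_, ?_, ?_⟩, fun s hs => iInter_subset (fun i : c => i.1) ⟨s, hs⟩⟩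
        · refine ⟨fun x hx => (hc hL₀).1.meas x (mem_iInter.1 hx ⟨L₀, hL₀⟩),
            fun x hx => (hc hL₀).1.mem x (mem_iInter.1 hx ⟨L₀, hL₀⟩), ?_, ?_, ?_⟩
          · exact fun x hx y hy => mem_iInter.2 fun i =>
              (hc i.2).1.mid x (mem_iInter.1 hx i) y (mem_iInter.1 hy i)
          · exact fun x hx y hy A hA => mem_iInter.2 fun i =>
              (hc i.2).1.pw x (mem_iInter.1 hx i) y (mem_iInter.1 hy i) A hA
          · exact fun z hz x hx h => mem_iInter.2 fun i =>
              (hc i.2).1.lim z (fun n => mem_iInter.1 (hz n) i) x hx h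
        · refine compactC hVc hV (fun i : c => i.1) (fun i => (hc i.2).1) (fun i => (hc i.2).2.1) ?_
          intro i j
          rcases hch.total i.2 j.2 with h | h
          · exact ⟨i, Subset.rfl, h⟩
          · exact ⟨j, h, Subset.rfl⟩
        · exact fun s hs x hx => mem_iInter.2 fun i => (hc i.2).2.2 s hs x (mem_iInter.1 hx i))
  exact ⟨K, hK.1.1, hK.1.2.1, hK.1.2.2, fun L hL h1 h2 h3 => hK.2 ⟨h1, h2, h3⟩ hL⟩

theorem norm_sub_midpoint_le (a x y : B) {c d : ℝ} (h1 : ‖a - x‖ ≤ c) (h2 : ‖a - y‖ ≤ d) :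
    ‖a - midpoint ℝ x y‖ ≤ (c + d) / 2 := by
  have e : a - midpoint ℝ x y = (1 / 2 : ℝ) • ((a - x) + (a - y)) := by
    rw [midpoint_eq_smul_add, invOf_eq_inv]; module
  rw [e, norm_smul]
  have := norm_add_le (a - x) (a - y)
  norm_num
  linarith

theorem norm_midpoint_sub_le (a x y : B) {c d : ℝ} (h1 : ‖x - a‖ ≤ c) (h2 : ‖y - a‖ ≤ d) :
    ‖midpoint ℝ x y - a‖ ≤ (c + d) / 2 := by
  rw [norm_sub_rev]
  exact norm_sub_midpoint_le a x y (by rwa [norm_sub_rev]) (by rwa [norm_sub_rev])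

/-- Directedness of the family of distances. -/
theorem dist_directed {V : Set B} {𝒮 : Set (Ω → B → B)} (hS : Core V P 𝒮) {K : Set (Ω → B)}
    (hK : MinK V P 𝒮 K) (x : Ω → B) (hx : x ∈ K) (s : Ω → B → B) (hs : s ∈ 𝒮) (k l : Ω → B)
    (hk : k ∈ K) (hl : l ∈ K) : ∃ m ∈ K, ∀ᵐ ω ∂P, ‖x ω - ap s k ω‖ ≤ ‖x ω - ap s m ω‖ ∧
      ‖x ω - ap s l ω‖ ≤ ‖x ω - ap s m ω‖ := by
  have hm : ∀ k ∈ K, AEMeasurable (fun ω => ‖x ω - ap s k ω‖) P := fun k hk =>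
    ((hK.stab.meas x hx).sub (hK.stab.meas _ (hK.inv s hs k hk))).norm.aemeasurable
  obtain ⟨A, hA, hA'⟩ : ∃ A : Set Ω, MeasurableSet A ∧
      ∀ ω, ω ∈ A ↔ (hm l hl).mk _ ω ≤ (hm k hk).mk _ ω :=
    ⟨_, measurableSet_le (hm l hl).measurable_mk (hm k hk).measurable_mk, fun _ => Iff.rfl⟩
  refine ⟨_, hK.stab.pw k hk l hl A hA, ?_⟩
  filter_upwards [(hm l hl).ae_eq_mk, (hm k hk).ae_eq_mk] with ω h1 h2
  have h3 := hA' ω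
  rw [← h1, ← h2] at h3
  by_cases h : ω ∈ A
  · simp only [ap, if_pos h] at *
    exact ⟨le_rfl, h3.1 h⟩
  · simp only [ap, if_neg h] at *
    exact ⟨(not_le.1 fun h' => h (h3.2 h')).le, le_rfl⟩

theorem exists_radius {V : Set B} (hVc : Convex ℝ V) (hV : WeaklyCompact V)
    {𝒮 : Set (Ω → B → B)} (hS : Core V P 𝒮) {K : Set (Ω → B)} (hK : MinK V P 𝒮 K) :
    ∃ ρ : Ω → ℝ, AEMeasurable ρ P ∧
      (∀ x ∈ K, ∀ s ∈ 𝒮, ∀ ε : ℝ≥0∞, 0 < ε →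
        ∃ k ∈ K, ∫⁻ ω, ENNReal.ofReal (ρ ω - ‖x ω - ap s k ω‖) ∂P ≤ ε) ∧
      ∃ z ∈ K, ∀ x ∈ K, ∀ᵐ ω ∂P, ‖x ω - z ω‖ ≤ ρ ω := by
  obtain ⟨C, hC0, hC⟩ := hV.bounded
  have hdist : ∀ u ∈ V, ∀ v ∈ V, ‖u - v‖ ≤ 2 * C := fun u hu v hv => by
    linarith [norm_sub_le u v, hC u hu, hC v hv]
  have hKV := hK.stab.mem
  have : Nonempty K := hK.ne.to_subtype
  have : Nonempty 𝒮 := ⟨⟨_, hS.one⟩⟩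
  -- the functions D
  have hD := fun (x : K) (s : 𝒮) => ess_sup_exists (P := P)
    (fun (k : K) ω => ‖x.1 ω - ap s.1 k.1 ω‖)
    (fun k => ((hK.stab.meas _ x.2).sub
      (hK.stab.meas _ (hK.inv _ s.2 _ k.2))).norm.aemeasurable) (2 * C)
    (fun k ω => by
      rw [abs_of_nonneg (norm_nonneg _)]
      exact hdist _ (hKV _ x.2 ω) _ (hKV _ (hK.inv _ s.2 _ k.2) ω))
  choose D kk hDm hDb hDs hDge hDle using hD
  have hr := fun (x : K) => ess_sup_exists (P := P) (fun (s : 𝒮) ω => - D x s ω)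
    (fun s => (hDm x s).neg) (2 * C) (fun s ω => by rw [abs_neg]; exact hDb x s ω)
  choose r' _ hrm hrb _ hrge hrle using hr
  let r : K → Ω → ℝ := fun x ω => - r' x ω
  have r_le : ∀ x s, ∀ᵐ ω ∂P, r x ω ≤ D x s ω := fun x s => by
    filter_upwards [hrge x s] with ω hω
    simp only [r]; linarith
  have le_r : ∀ x (g : Ω → ℝ), (∀ s, ∀ᵐ ω ∂P, g ω ≤ D x s ω) → ∀ᵐ ω ∂P, g ω ≤ r x ω := by
    intro x g hg
    filter_upwards [hrle x (fun ω => - g ω) (fun s => (hg s).mono fun ω hω => by linarith)]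
      with ω hω
    simp only [r]; linarith
  let mul : 𝒮 → 𝒮 → 𝒮 := fun s t => ⟨_, hS.mul _ s.2 _ t.2⟩
  let act : 𝒮 → K → K := fun s x => ⟨_, hK.inv _ s.2 _ x.2⟩
  have hmul : ∀ s t k, ap (mul s t).1 k = ap s.1 (ap t.1 k) := fun s t k => rfl
  have hcomm : ∀ (s t : 𝒮) (k : K), ap s.1 (ap t.1 k.1) = ap t.1 (ap s.1 k.1) := fun s t k => by
    ext ω; exact hS.comm _ s.2 _ t.2 ω _ (hKV _ k.2 ω)
  -- monotonicity of D
  have D_mul_left : ∀ x s t, ∀ᵐ ω ∂P, D x (mul s t) ω ≤ D x s ω := fun x s t =>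
    hDle x (mul s t) _ fun k => hDge x s (act t k)
  have D_mul_right : ∀ x s t, ∀ᵐ ω ∂P, D x (mul s t) ω ≤ D x t ω := fun x s t =>
    hDle x (mul s t) _ fun k => by
      have := hDge x t (act s k)
      rw [hmul, hcomm]; exact this
  have r_inv : ∀ t x, ∀ᵐ ω ∂P, r (act t x) ω ≤ r x ω := fun t x => le_r x _ fun s => by
    have h2 : ∀ᵐ ω ∂P, D (act t x) (mul t s) ω ≤ D x s ω := hDle _ _ _ fun k => by
      filter_upwards [hDge x s k] with ω hω
      exact (hS.nonexp _ t.2 ω _ (hKV _ x.2 ω) _ (hKV _ (act s k).2 ω)).trans hω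
    filter_upwards [r_le (act t x) (mul t s), h2] with ω h1 h2
    exact h1.trans h2
  have r_lip : ∀ x y : K, ∀ᵐ ω ∂P, r x ω ≤ r y ω + ‖x.1 ω - y.1 ω‖ := fun x y => by
    have : ∀ᵐ ω ∂P, r x ω - ‖x.1 ω - y.1 ω‖ ≤ r y ω := le_r y _ fun s => by
      have h2 : ∀ᵐ ω ∂P, D x s ω ≤ D y s ω + ‖x.1 ω - y.1 ω‖ := hDle _ _ _ fun k => by
        filter_upwards [hDge y s k] with ω hω
        have := norm_sub_le_norm_sub_add_norm_sub (x.1 ω) (y.1 ω) (ap s.1 k.1 ω)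
        linarith
      filter_upwards [r_le x s, h2] with ω h1 h2
      linarith
    filter_upwards [this] with ω hω
    linarith
  have r_mid : ∀ x y : K, ∀ᵐ ω ∂P,
      2 * r ⟨_, hK.stab.mid _ x.2 _ y.2⟩ ω ≤ r x ω + r y ω := fun x y => by
    set z : K := ⟨_, hK.stab.mid _ x.2 _ y.2⟩ with hz
    have h0 : ∀ s t, ∀ᵐ ω ∂P, 2 * r z ω ≤ D x s ω + D y t ω := fun s t => by
      have h2 : ∀ᵐ ω ∂P, D z (mul s t) ω ≤ (D x s ω + D y t ω) / 2 := hDle _ _ _ fun k => by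
        filter_upwards [hDge x s (act t k), hDge y t (act s k)] with ω h1 h2
        refine norm_midpoint_sub_le _ _ _ h1 ?_
        rw [hmul, hcomm]; exact h2
      filter_upwards [r_le z (mul s t), h2] with ω h1 h2
      linarith
    have h1 : ∀ t, ∀ᵐ ω ∂P, 2 * r z ω - D y t ω ≤ r x ω := fun t => le_r x _ fun s => by
      filter_upwards [h0 s t] with ω hω
      linarith
    have h2 : ∀ᵐ ω ∂P, 2 * r z ω - r x ω ≤ r y ω := le_r y _ fun t => by
      filter_upwards [h1 t] with ω hω
      linarith
    filter_upwards [h2] with ω hω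
    linarith
  have r_loc : ∀ (x z : K) (A : Set Ω), (∀ ω ∈ A, z.1 ω = x.1 ω) →
      ∀ᵐ ω ∂P, ω ∈ A → r z ω ≤ r x ω := fun x z A hA => by
    have : ∀ᵐ ω ∂P, (if ω ∈ A then r z ω else r x ω) ≤ r x ω := le_r x _ fun s => by
      have h2 : ∀ᵐ ω ∂P, D z s ω ≤ if ω ∈ A then D x s ω else D z s ω := hDle _ _ _ fun k => by
        filter_upwards [hDge x s k, hDge z s k] with ω h1 h2
        split_ifs with h
        · rw [hA ω h]; exact h1
        · exact h2
      filter_upwards [h2, r_le x s, r_le z s] with ω h2 h3 h4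
      split_ifs at * with h
      · exact h4.trans h2
      · exact h3
    filter_upwards [this] with ω hω h
    rwa [if_pos h] at hω
  -- constancy of r
  have r_const : ∀ x y : K, ∀ᵐ ω ∂P, r y ω ≤ r x ω := by
    intro x₀ y
    have hsub : K ⊆ {y | ∃ h : y ∈ K, ∀ᵐ ω ∂P, r ⟨y, h⟩ ω ≤ r x₀ ω} := by
      refine hK.min _ (fun y hy => hy.1) ⟨fun x hx => hK.stab.meas x hx.1,
        fun x hx => hKV x hx.1, ?_, ?_, ?_⟩ ⟨x₀.1, x₀.2, Eventually.of_forall fun _ => le_rfl⟩ ?_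
      · rintro x ⟨hx, hx'⟩ y ⟨hy, hy'⟩
        refine ⟨hK.stab.mid x hx y hy, ?_⟩
        filter_upwards [hx', hy', r_mid ⟨x, hx⟩ ⟨y, hy⟩] with ω h1 h2 h3
        linarith
      · rintro x ⟨hx, hx'⟩ y ⟨hy, hy'⟩ A hA
        refine ⟨hK.stab.pw x hx y hy A hA, ?_⟩
        filter_upwards [hx', hy', r_loc ⟨x, hx⟩ ⟨_, hK.stab.pw x hx y hy A hA⟩ A
          (fun ω h => if_pos h), r_loc ⟨y, hy⟩ ⟨_, hK.stab.pw x hx y hy A hA⟩ Aᶜ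
          (fun ω h => if_neg h)] with ω h1 h2 h3 h4
        by_cases h : ω ∈ A
        · exact (h3 h).trans h1
        · exact (h4 h).trans h2
      · intro z hz x hx hlim
        have hxK := hK.stab.lim z (fun n => (hz n).1) x hx hlim
        refine ⟨hxK, ?_⟩
        filter_upwards [hlim, ae_all_iff.2 fun n => (hz n).2,
          ae_all_iff.2 fun n => r_lip ⟨x, hxK⟩ ⟨z n, (hz n).1⟩] with ω h1 h2 h3
        have h4 : Tendsto (fun n => r x₀ ω + ‖x ω - z n ω‖) atTop (𝓝 (r x₀ ω + ‖x ω - x ω‖)) :=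
          tendsto_const_nhds.add (tendsto_const_nhds.sub h1).norm
        rw [sub_self, norm_zero, add_zero] at h4
        refine ge_of_tendsto' h4 fun n => ?_
        have a1 := h3 n
        have a2 := h2 n
        linarith
      · rintro s hs x ⟨hx, hx'⟩
        refine ⟨hK.inv s hs x hx, ?_⟩
        filter_upwards [hx', r_inv ⟨s, hs⟩ ⟨x, hx⟩] with ω h1 h2
        exact h2.trans h1
    exact (hsub y.2).2
  let x₁ : K := Classical.arbitrary K
  refine ⟨r x₁, (hrm x₁).neg, ?_, ?_⟩
  · intro x hx s hs ε hε
    have hpick := fun (k l : K) => dist_directed hS hK x hx s hs k.1 l.1 k.2 l.2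
    choose pick hpK hp using hpick
    let κ : ℕ → K := fun n => Nat.rec (kk ⟨x, hx⟩ ⟨s, hs⟩ 0)
      (fun n k => ⟨pick k (kk ⟨x, hx⟩ ⟨s, hs⟩ (n + 1)), hpK _ _⟩) n
    have hκ : ∀ᵐ ω ∂P, ∀ n, ‖x ω - ap s (κ n).1 ω‖ ≤ ‖x ω - ap s (κ (n + 1)).1 ω‖ ∧
        ‖x ω - ap s (kk ⟨x, hx⟩ ⟨s, hs⟩ (n + 1)).1 ω‖ ≤ ‖x ω - ap s (κ (n + 1)).1 ω‖ :=
      ae_all_iff.2 fun n => hp (κ n) (kk ⟨x, hx⟩ ⟨s, hs⟩ (n + 1))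
    have hlim : ∀ᵐ ω ∂P, Tendsto
        (fun n => ENNReal.ofReal (r x₁ ω - ‖x ω - ap s (κ n).1 ω‖)) atTop (𝓝 0) := by
      filter_upwards [hκ, r_const ⟨x, hx⟩ x₁, r_le ⟨x, hx⟩ ⟨s, hs⟩] with ω h1 h2 h3
      have hmono : Monotone fun n => ‖x ω - ap s (κ n).1 ω‖ :=
        monotone_nat_of_le_succ fun n => (h1 n).1
      have hge : ∀ n, ‖x ω - ap s (kk ⟨x, hx⟩ ⟨s, hs⟩ n).1 ω‖ ≤ ‖x ω - ap s (κ n).1 ω‖ := by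
        intro n
        cases n with
        | zero => exact le_rfl
        | succ n => exact (h1 n).2
      rw [ENNReal.tendsto_atTop_zero]
      intro δ hδ
      obtain ⟨η, hη0, hη⟩ := ENNReal.lt_iff_exists_real_btwn.1 hδ
      have hηp : 0 < η := by simpa using hη.1
      have h4 : r x₁ ω ≤ ⨆ n, ‖x ω - ap s (kk ⟨x, hx⟩ ⟨s, hs⟩ n).1 ω‖ := by
        have := hDs ⟨x, hx⟩ ⟨s, hs⟩ ω
        dsimp only at this
        rw [← this]; exact h2.trans h3
      obtain ⟨n, hn⟩ := exists_lt_of_lt_ciSup (show r x₁ ω - η <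
        ⨆ n, ‖x ω - ap s (kk ⟨x, hx⟩ ⟨s, hs⟩ n).1 ω‖ by linarith)
      refine ⟨n, fun m hm => (ENNReal.ofReal_le_ofReal ?_).trans hη.2.le⟩
      have a1 := hge n
      have a2 := hmono hm
      dsimp only at a2
      linarith
    have hintg := tendsto_lintegral_of_dominated_convergence' (μ := P)
      (F := fun n ω => ENNReal.ofReal (r x₁ ω - ‖x ω - ap s (κ n).1 ω‖)) (f := fun _ => 0)
      (fun _ => ENNReal.ofReal (2 * C)) (fun n => (((hrm x₁).neg).sub
        ((hK.stab.meas x hx).sub (hK.stab.meas _ (hK.inv s hs _ (κ n).2))).norm.aemeasurable).ennreal_ofReal)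
      (fun n => Eventually.of_forall fun ω => ENNReal.ofReal_le_ofReal (by
        have a1 := (abs_le.1 (hrb x₁ ω)).1
        have a2 := norm_nonneg (x ω - ap s (κ n).1 ω)
        simp only [r]
        linarith)) (by rw [lintegral_const]; simp [ENNReal.mul_eq_top]) hlim
    rw [lintegral_zero] at hintg
    obtain ⟨n, hn⟩ := ((ENNReal.tendsto_atTop_zero.1 hintg) ε hε)
    exact ⟨(κ n).1, (κ n).2, hn n le_rfl⟩
  · have hZ := compactC (P := P) hVc hV
      (fun s : 𝒮 => {z | z ∈ K ∧ ∀ x : K, ∀ᵐ ω ∂P, ‖x.1 ω - z ω‖ ≤ D x s ω}) (fun s => by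
        refine ⟨fun x hx => hK.stab.meas x hx.1, fun x hx => hKV x hx.1, ?_, ?_, ?_⟩
        · rintro y ⟨hy, hy'⟩ z ⟨hz, hz'⟩
          refine ⟨hK.stab.mid y hy z hz, fun x => ?_⟩
          filter_upwards [hy' x, hz' x] with ω h1 h2
          linarith [norm_sub_midpoint_le _ _ _ h1 h2]
        · rintro y ⟨hy, hy'⟩ z ⟨hz, hz'⟩ A hA
          refine ⟨hK.stab.pw y hy z hz A hA, fun x => ?_⟩
          filter_upwards [hy' x, hz' x] with ω h1 h2
          split_ifs
          · exact h1
          · exact h2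
        · intro z hz y hy hlim
          refine ⟨hK.stab.lim z (fun n => (hz n).1) y hy hlim, fun x => ?_⟩
          filter_upwards [hlim, ae_all_iff.2 fun n => (hz n).2 x] with ω h1 h2
          exact le_of_tendsto' (tendsto_const_nhds.sub h1).norm h2)
      (fun s => ⟨ap s.1 x₁.1, hK.inv _ s.2 _ x₁.2, fun x => hDge x s x₁⟩)
      (fun s t => ⟨mul s t, fun z hz => ⟨hz.1, fun x => by
          filter_upwards [hz.2 x, D_mul_left x s t] with ω h1 h2
          exact h1.trans h2⟩, fun z hz => ⟨hz.1, fun x => by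
          filter_upwards [hz.2 x, D_mul_right x s t] with ω h1 h2
          exact h1.trans h2⟩⟩)
    obtain ⟨z, hz⟩ := hZ
    rw [mem_iInter] at hz
    refine ⟨z, (hz ⟨_, hS.one⟩).1, fun x hx => ?_⟩
    have h1 : ∀ᵐ ω ∂P, ‖x ω - z ω‖ ≤ r ⟨x, hx⟩ ω := le_r ⟨x, hx⟩ _ fun s => (hz s).2 ⟨x, hx⟩
    filter_upwards [h1, r_const x₁ ⟨x, hx⟩] with ω h1 h2
    exact h1.trans h2

theorem radius_nonpos {V : Set B} (hVc : Convex ℝ V) (hV : WeaklyCompact V)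
    (hns : NormalStructure V)
    {𝒮 : Set (Ω → B → B)} (hS : Core V P 𝒮) {K : Set (Ω → B)} (hK : MinK V P 𝒮 K)
    (ρ : Ω → ℝ) (hρm : AEMeasurable ρ P)
    (hρ : ∀ x ∈ K, ∀ s ∈ 𝒮, ∀ ε : ℝ≥0∞, 0 < ε →
        ∃ k ∈ K, ∫⁻ ω, ENNReal.ofReal (ρ ω - ‖x ω - ap s k ω‖) ∂P ≤ ε)
    (z : Ω → B) (hz : z ∈ K) (hzρ : ∀ x ∈ K, ∀ᵐ ω ∂P, ‖x ω - z ω‖ ≤ ρ ω) :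
    ∀ᵐ ω ∂P, ρ ω ≤ 0 := by
  obtain ⟨C, hC0, hC⟩ := hV.bounded
  have hdist : ∀ u ∈ V, ∀ v ∈ V, ‖u - v‖ ≤ 2 * C := fun u hu v hv => by
    linarith [norm_sub_le u v, hC u hu, hC v hv]
  have hKV := hK.stab.mem
  let Q : (Ω → B → B) → (Ω → B) → Prop := fun s x => ∀ k ∈ K, ∀ᵐ ω ∂P, ‖x ω - ap s k ω‖ ≤ ρ ω
  have Q_left : ∀ s t x, t ∈ 𝒮 → Q s x → Q (fun ω v => s ω (t ω v)) x := fun s t x ht h k hk =>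
    h _ (hK.inv t ht k hk)
  have Q_right : ∀ s ∈ 𝒮, ∀ t ∈ 𝒮, ∀ x, Q t x → Q (fun ω v => s ω (t ω v)) x :=
    fun s hs t ht x h k hk => by
      filter_upwards [h _ (hK.inv s hs k hk)] with ω hω
      have : ap (fun ω v => s ω (t ω v)) k ω = ap t (ap s k) ω :=
        hS.comm s hs t ht ω _ (hKV k hk ω)
      rw [this]; exact hω
  let U : Set (Ω → B) := {x | x ∈ K ∧ ∃ s ∈ 𝒮, Q s x}
  have hzU : z ∈ U := ⟨hz, _, hS.one, fun k hk => by
    filter_upwards [hzρ k hk] with ω hω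
    rw [norm_sub_rev]; exact hω⟩
  have hUinv : ∀ t ∈ 𝒮, ∀ x ∈ U, ap t x ∈ U := by
    rintro t ht x ⟨hx, s, hs, hQ⟩
    refine ⟨hK.inv t ht x hx, _, hS.mul t ht s hs, fun k hk => ?_⟩
    filter_upwards [hQ k hk] with ω hω
    exact (hS.nonexp t ht ω _ (hKV x hx ω) _ (hKV _ (hK.inv s hs k hk) ω)).trans hω
  have hUmid : ∀ x ∈ U, ∀ y ∈ U, (fun ω => midpoint ℝ (x ω) (y ω)) ∈ U := by
    rintro x ⟨hx, s, hs, hsQ⟩ y ⟨hy, t, ht, htQ⟩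
    refine ⟨hK.stab.mid x hx y hy, _, hS.mul s hs t ht, fun k hk => ?_⟩
    filter_upwards [Q_left s t x ht hsQ k hk, Q_right s hs t ht y htQ k hk] with ω h1 h2
    linarith [norm_midpoint_sub_le _ _ _ h1 h2]
  have hUpw : ∀ x ∈ U, ∀ y ∈ U, ∀ A : Set Ω, MeasurableSet A →
      (fun ω => if ω ∈ A then x ω else y ω) ∈ U := by
    rintro x ⟨hx, s, hs, hsQ⟩ y ⟨hy, t, ht, htQ⟩ A hA
    refine ⟨hK.stab.pw x hx y hy A hA, _, hS.mul s hs t ht, fun k hk => ?_⟩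
    filter_upwards [Q_left s t x ht hsQ k hk, Q_right s hs t ht y htQ k hk] with ω h1 h2
    split_ifs
    · exact h1
    · exact h2
  -- density of U
  have hem : ∀ x ∈ K, ∀ y ∈ K, AEMeasurable (fun ω => ‖x ω - y ω‖ₑ) P := fun x hx y hy =>
    ((hK.stab.meas x hx).sub (hK.stab.meas y hy)).enorm
  have hdense : K ⊆ {x | x ∈ K ∧ ∀ ε : ℝ≥0∞, 0 < ε → ∃ u ∈ U, ∫⁻ ω, ‖x ω - u ω‖ₑ ∂P ≤ ε} := by
    refine hK.min _ (fun x hx => hx.1) ⟨fun x hx => hK.stab.meas x hx.1,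
      fun x hx => hKV x hx.1, ?_, ?_, ?_⟩ ⟨z, hz, fun ε _ => ⟨z, hzU, by simp⟩⟩ ?_
    · rintro x ⟨hx, hx'⟩ y ⟨hy, hy'⟩
      refine ⟨hK.stab.mid x hx y hy, fun ε hε => ?_⟩
      obtain ⟨u, hu, hu'⟩ := hx' (ε / 2) (ENNReal.half_pos hε.ne')
      obtain ⟨v, hv, hv'⟩ := hy' (ε / 2) (ENNReal.half_pos hε.ne')
      refine ⟨_, hUmid u hu v hv, ?_⟩
      calc _ ≤ ∫⁻ ω, (‖x ω - u ω‖ₑ + ‖y ω - v ω‖ₑ) ∂P := lintegral_mono fun ω => by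
            have e : midpoint ℝ (x ω) (y ω) - midpoint ℝ (u ω) (v ω)
                = (1 / 2 : ℝ) • ((x ω - u ω) + (y ω - v ω)) := by
              simp only [midpoint_eq_smul_add, invOf_eq_inv]; module
            dsimp only
            rw [e, ← ofReal_norm, ← ofReal_norm, ← ofReal_norm,
              ← ENNReal.ofReal_add (norm_nonneg _) (norm_nonneg _), norm_smul]
            refine ENNReal.ofReal_le_ofReal ?_
            have := norm_add_le (x ω - u ω) (y ω - v ω)
            have := norm_nonneg (x ω - u ω + (y ω - v ω))
            norm_num
            linarith
        _ = _ := lintegral_add_left' (hem x hx u hu.1) _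
        _ ≤ ε / 2 + ε / 2 := add_le_add hu' hv'
        _ = ε := ENNReal.add_halves ε
    · rintro x ⟨hx, hx'⟩ y ⟨hy, hy'⟩ A hA
      refine ⟨hK.stab.pw x hx y hy A hA, fun ε hε => ?_⟩
      obtain ⟨u, hu, hu'⟩ := hx' (ε / 2) (ENNReal.half_pos hε.ne')
      obtain ⟨v, hv, hv'⟩ := hy' (ε / 2) (ENNReal.half_pos hε.ne')
      refine ⟨_, hUpw u hu v hv A hA, ?_⟩
      calc _ ≤ ∫⁻ ω, (‖x ω - u ω‖ₑ + ‖y ω - v ω‖ₑ) ∂P := lintegral_mono fun ω => by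
            dsimp only
            split_ifs
            · exact le_self_add
            · exact le_add_self
        _ = _ := lintegral_add_left' (hem x hx u hu.1) _
        _ ≤ ε / 2 + ε / 2 := add_le_add hu' hv'
        _ = ε := ENNReal.add_halves ε
    · intro y hy x hx hlim
      have hxK := hK.stab.lim y (fun n => (hy n).1) x hx hlim
      refine ⟨hxK, fun ε hε => ?_⟩
      have hintg := tendsto_lintegral_of_dominated_convergence' (μ := P)
        (F := fun n ω => ‖x ω - y n ω‖ₑ) (f := fun _ => 0)
        (fun _ => ENNReal.ofReal (2 * C)) (fun n => hem x hxK _ (hy n).1)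
        (fun n => Eventually.of_forall fun ω => by
          dsimp only
          rw [← ofReal_norm]
          exact ENNReal.ofReal_le_ofReal (hdist _ (hx ω) _ (hKV _ (hy n).1 ω)))
        (by rw [lintegral_const]; simp [ENNReal.mul_eq_top]) (by
          filter_upwards [hlim] with ω hω
          have := tendsto_iff_edist_tendsto_0.1 hω
          simpa only [edist_comm _ (x ω), edist_eq_enorm_sub] using this)
      rw [lintegral_zero] at hintg
      obtain ⟨n, hn⟩ := ENNReal.tendsto_atTop_zero.1 hintg (ε / 2) (ENNReal.half_pos hε.ne')
      obtain ⟨u, hu, hu'⟩ := (hy n).2 (ε / 2) (ENNReal.half_pos hε.ne')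
      refine ⟨u, hu, ?_⟩
      calc _ ≤ ∫⁻ ω, (‖x ω - y n ω‖ₑ + ‖y n ω - u ω‖ₑ) ∂P := lintegral_mono fun ω => by
            simp only [← edist_eq_enorm_sub]
            exact edist_triangle _ _ _
        _ = _ := lintegral_add_left' (hem x hxK _ (hy n).1) _
        _ ≤ ε / 2 + ε / 2 := add_le_add (hn n le_rfl) hu'
        _ = ε := ENNReal.add_halves ε
    · rintro s hs x ⟨hx, hx'⟩
      refine ⟨hK.inv s hs x hx, fun ε hε => ?_⟩
      obtain ⟨u, hu, hu'⟩ := hx' ε hε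
      refine ⟨_, hUinv s hs u hu, le_trans (lintegral_mono fun ω => ?_) hu'⟩
      rw [← ofReal_norm, ← ofReal_norm]
      exact ENNReal.ofReal_le_ofReal (hS.nonexp s hs ω _ (hKV x hx ω) _ (hKV u hu.1 ω))
  have happ : ∀ x ∈ K, ∀ s ∈ 𝒮, ∀ ε : ℝ≥0∞, 0 < ε →
      ∃ u ∈ U, ∫⁻ ω, ENNReal.ofReal (ρ ω - ‖x ω - ap s u ω‖) ∂P ≤ ε := by
    intro x hx s hs ε hε
    obtain ⟨k, hk, hk'⟩ := hρ x hx s hs (ε / 2) (ENNReal.half_pos hε.ne')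
    obtain ⟨u, hu, hu'⟩ := (hdense hk).2 (ε / 2) (ENNReal.half_pos hε.ne')
    refine ⟨u, hu, ?_⟩
    calc _ ≤ ∫⁻ ω, (ENNReal.ofReal (ρ ω - ‖x ω - ap s k ω‖) + ‖k ω - u ω‖ₑ) ∂P :=
          lintegral_mono fun ω => by
            dsimp only
            rw [← ofReal_norm]
            refine le_trans (ENNReal.ofReal_le_ofReal ?_) ENNReal.ofReal_add_le
            have h1 := hS.nonexp s hs ω _ (hKV k hk ω) _ (hKV u hu.1 ω)
            have h2 := norm_sub_le_norm_sub_add_norm_sub (x ω) (ap s u ω) (ap s k ω)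
            rw [norm_sub_rev] at h1
            simp only [ap] at *
            linarith
      _ = _ := lintegral_add_right' _ (hem k hk u hu.1)
      _ ≤ ε / 2 + ε / 2 := add_le_add hk' hu'
      _ = ε := ENNReal.add_halves ε
  -- the sequence
  let St := {q : (Ω → B) × (Ω → B) × (Ω → B → B) // q.1 ∈ K ∧ q.2.1 ∈ K ∧ q.2.2 ∈ 𝒮 ∧ Q q.2.2 q.1}
  have hstep : ∀ (n : ℕ) (q : St), ∃ q' : St,
      (q'.1.2.1 = fun ω => midpoint ℝ (q.1.2.1 ω) (q'.1.1 ω)) ∧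
      (∃ u ∈ K, q'.1.1 = ap q.1.2.2 u) ∧ (∀ y, Q q.1.2.2 y → Q q'.1.2.2 y) ∧
      ∫⁻ ω, ENNReal.ofReal (ρ ω - ‖q.1.2.1 ω - q'.1.1 ω‖) ∂P ≤ ENNReal.ofReal ((1 / 4) ^ n) := by
    rintro n ⟨⟨x, a, s⟩, hx, ha, hs, hq⟩
    obtain ⟨u, hu, hu'⟩ := happ a ha s hs (ENNReal.ofReal ((1 / 4) ^ n))
      (ENNReal.ofReal_pos.2 (by positivity))
    obtain ⟨hxK, t, ht, htQ⟩ := hUinv s hs u hu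
    exact ⟨⟨⟨ap s u, fun ω => midpoint ℝ (a ω) (ap s u ω), fun ω v => s ω (t ω v)⟩,
      hxK, hK.stab.mid _ ha _ hxK, hS.mul s hs t ht, Q_right s hs t ht _ htQ⟩, rfl,
      ⟨u, hu.1, rfl⟩, fun y hy => Q_left s t y ht hy, hu'⟩
  choose next hn1 hn2 hn3 hn4 using hstep
  let q0 : St := ⟨⟨z, z, fun _ x => x⟩, hz, hz, hS.one, fun k hk => by
    filter_upwards [hzρ k hk] with ω hω
    rw [norm_sub_rev]; exact hω⟩
  let q : ℕ → St := fun n => Nat.rec q0 (fun n p => next n p) n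
  have hQ : ∀ i j, Q (q (i + j)).1.2.2 (q i).1.1 := by
    intro i j
    induction j with
    | zero => exact (q i).2.2.2.2
    | succ j ih => exact hn3 (i + j) (q (i + j)) _ ih
  have hlt : ∀ i j, i < j → ∀ᵐ ω ∂P, ‖(q i).1.1 ω - (q j).1.1 ω‖ ≤ ρ ω := by
    intro i j hij
    obtain ⟨d, rfl⟩ : ∃ d, j = i + d + 1 := ⟨j - i - 1, by omega⟩
    obtain ⟨u, hu, hu'⟩ := hn2 (i + d) (q (i + d))
    have := hQ i d u hu
    rw [← hu'] at this
    exact this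
  have hall : ∀ᵐ ω ∂P, ∀ i j, ‖(q i).1.1 ω - (q j).1.1 ω‖ ≤ ρ ω := by
    refine ae_all_iff.2 fun i => ae_all_iff.2 fun j => ?_
    rcases lt_trichotomy i j with h | h | h
    · exact hlt i j h
    · subst h
      filter_upwards [hzρ z hz] with ω hω
      simpa using hω
    · filter_upwards [hlt j i h] with ω hω
      rw [norm_sub_rev]; exact hω
  have hsm : ∀ n, AEMeasurable
      (fun ω => ENNReal.ofReal (ρ ω - ‖(q n).1.2.1 ω - (q (n + 1)).1.1 ω‖)) P := fun n =>
    (hρm.sub ((hK.stab.meas _ (q n).2.2.1).sub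
      (hK.stab.meas _ (q (n + 1)).2.1)).norm.aemeasurable).ennreal_ofReal
  have hlim := ae_tendsto_zero (P := P) (fun n ω => ENNReal.ofReal (2 ^ n) *
      ENNReal.ofReal (ρ ω - ‖(q n).1.2.1 ω - (q (n + 1)).1.1 ω‖))
    (fun n => (hsm n).const_mul _) (by
      refine ne_top_of_le_ne_top (b := ∑' n : ℕ, ENNReal.ofReal ((1 / 2) ^ n)) ?_
        (ENNReal.tsum_le_tsum fun n => ?_)
      · rw [← ENNReal.ofReal_tsum_of_nonneg (fun n => by positivity) summable_geometric_two]
        exact ENNReal.ofReal_ne_top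
      · rw [lintegral_const_mul' _ _ ENNReal.ofReal_ne_top]
        refine (mul_le_mul_right (hn4 n (q n)) _).trans ?_
        rw [← ENNReal.ofReal_mul (by positivity), ← mul_pow]
        norm_num)
  filter_upwards [hall, hlim] with ω h1 h2
  refine diametral_seq hV.isClosed hVc hns (fun n => (q n).1.1 ω) (fun n => (q n).1.2.1 ω)
    (fun n => hKV _ (q n).2.1 ω) rfl (fun n => congrFun (hn1 n (q n)) ω) (ρ ω) h1
    (fun n => max (ρ ω - ‖(q n).1.2.1 ω - (q (n + 1)).1.1 ω‖) 0)
    (fun n => by linarith [le_max_left (ρ ω - ‖(q n).1.2.1 ω - (q (n + 1)).1.1 ω‖) 0]) ?_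
  have := (ENNReal.tendsto_toReal ENNReal.zero_ne_top).comp h2
  simpa [Function.comp_def, ENNReal.toReal_mul, ENNReal.toReal_ofReal'] using this

theorem core_fixed {V : Set B} (hVne : V.Nonempty) (hVc : Convex ℝ V) (hV : WeaklyCompact V)
    (hns : NormalStructure V) {𝒮 : Set (Ω → B → B)} (hS : Core V P 𝒮) :
    ∃ z ∈ L0 V P, ∀ s ∈ 𝒮, ∀ᵐ ω ∂P, s ω (z ω) = z ω := by
  obtain ⟨K, hK⟩ := exists_minK hVne hVc hV hS
  obtain ⟨ρ, hρm, hρ, z, hz, hzρ⟩ := exists_radius hVc hV hS hK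
  have h0 := radius_nonpos hVc hV hns hS hK ρ hρm hρ z hz hzρ
  refine ⟨z, ⟨hK.stab.meas z hz, hK.stab.mem z hz⟩, fun s hs => ?_⟩
  filter_upwards [h0, hzρ _ (hK.inv s hs z hz)] with ω h1 h2
  have : ‖ap s z ω - z ω‖ ≤ 0 := h2.trans h1
  exact sub_eq_zero.1 (norm_le_zero_iff.1 this)

/-- The semigroup generated by a family of random operators. -/
inductive Gen (𝒯 : Set (Ω → B → B)) : (Ω → B → B) → Prop
  | one : Gen 𝒯 (fun _ x => x)
  | cons (T S : Ω → B → B) : T ∈ 𝒯 → Gen 𝒯 S → Gen 𝒯 (fun ω x => T ω (S ω x))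

theorem core_gen {V : Set B} (hVne : V.Nonempty) (hVc : Convex ℝ V) (𝒯 : Set (Ω → B → B))
    (hmaps : ∀ T ∈ 𝒯, ∀ ω : Ω, Set.MapsTo (T ω) V V)
    (hmeas : ∀ T ∈ 𝒯, ∀ x ∈ V, AEStronglyMeasurable (fun ω => T ω x) P)
    (hnonexp : ∀ T ∈ 𝒯, ∀ ω : Ω, ∀ x ∈ V, ∀ y ∈ V, ‖T ω x - T ω y‖ ≤ ‖x - y‖)
    (hcomm : ∀ T ∈ 𝒯, ∀ S ∈ 𝒯, ∀ ω : Ω, ∀ x ∈ V, T ω (S ω x) = S ω (T ω x)) :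
    Core V P {s | Gen 𝒯 s} := by
  have maps : ∀ T, Gen 𝒯 T → ∀ ω : Ω, Set.MapsTo (T ω) V V := by
    intro T hT
    induction hT with
    | one => exact fun ω x hx => hx
    | cons T S hT hS ih => exact fun ω x hx => hmaps T hT ω (ih ω hx)
  have comm1 : ∀ T ∈ 𝒯, ∀ S, Gen 𝒯 S → ∀ ω : Ω, ∀ x ∈ V, T ω (S ω x) = S ω (T ω x) := by
    intro T hT S hS
    induction hS with
    | one => exact fun ω x hx => rfl
    | cons T' S hT' hS ih =>
      intro ω x hx
      rw [hcomm T hT T' hT' ω _ (maps S hS ω hx), ih ω x hx]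
  refine ⟨maps, ?_, ?_, ?_, Gen.one, ?_⟩
  · intro T hT
    induction hT with
    | one => exact fun x hx => hx.1
    | cons T S hT hS ih =>
      exact fun x hx => ap_meas hVne hVc T (hmaps T hT) (hmeas T hT) (hnonexp T hT) (ap S x)
        ⟨ih x hx, fun ω => maps S hS ω (hx.2 ω)⟩
  · intro T hT
    induction hT with
    | one => exact fun ω x _ y _ => le_rfl
    | cons T S hT hS ih =>
      exact fun ω x hx y hy => (hnonexp T hT ω _ (maps S hS ω hx) _ (maps S hS ω hy)).trans
        (ih ω x hx y hy)
  · intro T hT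
    induction hT with
    | one => exact fun S _ ω x _ => rfl
    | cons T T' hT hT' ih =>
      intro S hS ω x hx
      dsimp only
      rw [ih S hS ω x hx, comm1 T hT S hS ω _ (maps T' hT' ω hx)]
  · intro T hT S hS
    induction hT with
    | one => exact hS
    | cons T T' hT hT' ih => exact Gen.cons T _ hT ih

end Helpers

/-- A commutative family of strong random nonexpansive operators from `Ω × V` to `V`,
where `V` is a nonempty weakly compact convex subset with normal structure of a Banach
space `B`, has a common random fixed point. -/
theorem common_random_fixed_point_of_commutative_nonexpansive
    {B : Type*} [NormedAddCommGroup B] [NormedSpace ℝ B] [CompleteSpace B]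
    (V : Set B) (hVne : V.Nonempty) (hVconv : Convex ℝ V)
    (hVwc : WeaklyCompact V) (hVns : NormalStructure V)
    {Ω : Type*} [MeasurableSpace Ω] (P : Measure Ω) [IsProbabilityMeasure P]
    (𝒯 : Set (Ω → B → B))
    (hmaps : ∀ T ∈ 𝒯, ∀ ω : Ω, Set.MapsTo (T ω) V V)
    (hmeas : ∀ T ∈ 𝒯, ∀ x ∈ V, AEStronglyMeasurable (fun ω => T ω x) P)
    (hnonexp : ∀ T ∈ 𝒯, ∀ ω : Ω, ∀ x ∈ V, ∀ y ∈ V, ‖T ω x - T ω y‖ ≤ ‖x - y‖)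
    (hcomm : ∀ T ∈ 𝒯, ∀ S ∈ 𝒯, ∀ ω : Ω, ∀ x ∈ V, T ω (S ω x) = S ω (T ω x)) :
    ∃ x0 : Ω → B, AEStronglyMeasurable x0 P ∧ (∀ ω, x0 ω ∈ V) ∧
      ∀ T ∈ 𝒯, ∀ᵐ ω ∂P, T ω (x0 ω) = x0 ω := by
  obtain ⟨z, hz, hfix⟩ := core_fixed hVne hVconv hVwc hVns
    (core_gen (P := P) hVne hVconv 𝒯 hmaps hmeas hnonexp hcomm)
  exact ⟨z, hz.1, hz.2, fun T hT => hfix T (Gen.cons T _ hT Gen.one)⟩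

end RNM
end
end

section
/- Let B be a real Banach space, V a nonempty weakly compact convex subset of B, and L⁰(𝓕,V) := {x ∈ L⁰(𝓕,B) : x(ω) ∈ V for almost all ω}. Then the random Chebyshev center of L⁰(𝓕,V) equals L⁰(𝓕, c(V,V)): an element x ∈ L⁰(𝓕,V) satisfies R(L⁰(𝓕,V), x) = R(L⁰(𝓕,V), L⁰(𝓕,V)) if and only if x(ω) ∈ c(V,V) for almost all ω ∈ Ω; moreover, R(L⁰(𝓕,V), L⁰(𝓕,V)) equals the constant function with value r(V,V), and for each x ∈ L⁰(𝓕,V), R(L⁰(𝓕,V), x) is the equivalence class of ω ↦ sup_{v∈V} ‖x(ω) − v‖. -/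
open MeasureTheory Set Filter Function
open scoped Classical

noncomputable section

namespace RNM


variable {B : Type*} [NormedAddCommGroup B] [NormedSpace ℝ B]

variable {Ω : Type*} [MeasurableSpace Ω] {P : Measure Ω}
variable {B : Type*} [NormedAddCommGroup B] [NormedSpace ℝ B]

/-- The pointwise norm of `x ∈ L⁰(𝓕,B)` as an element of `L⁰(𝓕,ℝ)`. -/
def nrm (x : Ω →ₘ[P] B) : Ω →ₘ[P] ℝ := x.comp norm continuous_norm

/-- The module action of `L⁰(𝓕,ℝ)` on `L⁰(𝓕,B)` (pointwise scalar multiplication). -/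
def msmul (l : Ω →ₘ[P] ℝ) (x : Ω →ₘ[P] B) : Ω →ₘ[P] B :=
  AEEqFun.comp₂ (fun c (b : B) => c • b) continuous_smul l x

/-- `Ĩ_A`, the equivalence class of the indicator function of `A`, in `L⁰(𝓕,ℝ)`. -/
def ind (A : Set Ω) (hA : MeasurableSet A) : Ω →ₘ[P] ℝ :=
  AEEqFun.mk (A.indicator fun _ => (1 : ℝ))
    ((measurable_const.indicator hA).aestronglyMeasurable)

/-- A subset of `L⁰(𝓕,B)` is a.s. bounded if the norms of its members have a common
bound in `L⁰(𝓕,ℝ)`. -/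
def ASBounded (H : Set (Ω →ₘ[P] B)) : Prop :=
  ∃ ξ : Ω →ₘ[P] ℝ, ∀ h ∈ H, nrm h ≤ ξ

/-- The supremum of a subset of `L⁰(𝓕,ℝ)` (junk value `0` if no least upper bound exists;
for nonempty a.s. bounded-above sets the least upper bound always exists, by Dedekind
completeness of `L⁰(𝓕,ℝ)`). -/
def lsup (S : Set (Ω →ₘ[P] ℝ)) : Ω →ₘ[P] ℝ :=
  if h : ∃ ξ, IsLUB S ξ then h.choose else 0

/-- The infimum of a subset of `L⁰(𝓕,ℝ)` (junk value `0` if no greatest lower bound exists). -/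
def linf (S : Set (Ω →ₘ[P] ℝ)) : Ω →ₘ[P] ℝ :=
  if h : ∃ ξ, IsGLB S ξ then h.choose else 0

/-- The random Chebyshev radius `R(H,x)` of `H` at `x`. -/
def Rr (H : Set (Ω →ₘ[P] B)) (x : Ω →ₘ[P] B) : Ω →ₘ[P] ℝ :=
  lsup ((fun y => nrm (x - y)) '' H)

/-- The random Chebyshev radius `R(H,G)` of `H` with respect to `G`. -/
def RrS (H G : Set (Ω →ₘ[P] B)) : Ω →ₘ[P] ℝ :=
  linf ((fun x => Rr H x) '' G)

/-- The random Chebyshev center `C(H,G)` of `H` with respect to `G`. -/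
def Cc (H G : Set (Ω →ₘ[P] B)) : Set (Ω →ₘ[P] B) :=
  {x ∈ G | Rr H x = RrS H G}

/-- The random diameter `D(H)`. -/
def Dd (H : Set (Ω →ₘ[P] B)) : Ω →ₘ[P] ℝ :=
  lsup {ξ | ∃ x ∈ H, ∃ y ∈ H, ξ = nrm (x - y)}

/-- A subset of `L⁰(𝓕,B)` is closed if it is sequentially closed under convergence in
probability (the `(ε,λ)`-topology). -/
def SeqClosed (S : Set (Ω →ₘ[P] B)) : Prop :=
  ∀ (x : ℕ → Ω →ₘ[P] B) (y : Ω →ₘ[P] B), (∀ n, x n ∈ S) →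
    TendstoInMeasure P (fun n => (x n : Ω → B)) atTop y → y ∈ S

/-- The closure of a subset of `L⁰(𝓕,B)` under convergence in probability. -/
def seqClosure (S : Set (Ω →ₘ[P] B)) : Set (Ω →ₘ[P] B) :=
  {y | ∃ x : ℕ → Ω →ₘ[P] B, (∀ n, x n ∈ S) ∧
    TendstoInMeasure P (fun n => (x n : Ω → B)) atTop y}

/-- `L⁰`-convexity. -/
def LConvex (G : Set (Ω →ₘ[P] B)) : Prop :=
  ∀ x ∈ G, ∀ y ∈ G, ∀ l : Ω →ₘ[P] ℝ, 0 ≤ l → l ≤ 1 →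
    msmul l x + msmul (1 - l) y ∈ G

/-- `L⁰`-convex compactness: `G` is a nonempty closed `L⁰`-convex set such that every family
of nonempty closed `L⁰`-convex subsets of `G` with the finite intersection property has
nonempty intersection. -/
def ConvexlyCompact (G : Set (Ω →ₘ[P] B)) : Prop :=
  G.Nonempty ∧ SeqClosed G ∧ LConvex G ∧
    ∀ 𝒞 : Set (Set (Ω →ₘ[P] B)),
      (∀ C ∈ 𝒞, C.Nonempty ∧ C ⊆ G ∧ SeqClosed C ∧ LConvex C) →
      (∀ S : Finset (Set (Ω →ₘ[P] B)), ↑S ⊆ 𝒞 → (⋂₀ (S : Set (Set (Ω →ₘ[P] B)))).Nonempty) →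
      (⋂₀ 𝒞).Nonempty

/-- Random normal structure. -/
def RandNormalStructure (G : Set (Ω →ₘ[P] B)) : Prop :=
  ∀ H ⊆ G, H.Nonempty → ASBounded H → SeqClosed H → LConvex H → Dd H ≠ 0 →
    ∃ z ∈ H, ∀ᵐ ω ∂P, 0 < Dd H ω → Rr H z ω < Dd H ω

/-- A nonexpansive mapping (on `G`). -/
def NonexpansiveOn (G : Set (Ω →ₘ[P] B)) (T : (Ω →ₘ[P] B) → (Ω →ₘ[P] B)) : Prop :=
  ∀ x ∈ G, ∀ y ∈ G, nrm (T x - T y) ≤ nrm (x - y)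

/-- An isometric mapping (on `G`). -/
def IsometricOn (G : Set (Ω →ₘ[P] B)) (T : (Ω →ₘ[P] B) → (Ω →ₘ[P] B)) : Prop :=
  ∀ x ∈ G, ∀ y ∈ G, nrm (T x - T y) = nrm (x - y)

/-- A countable measurable partition of `Ω`. -/
def IsPartition (A : ℕ → Set Ω) : Prop :=
  (∀ n, MeasurableSet (A n)) ∧ Pairwise (Disjoint on A) ∧ (⋃ n, A n) = univ

/-- `y` is the countable concatenation `Σ_n Ĩ_{A_n} x_n`,
i.e. `y` agrees a.s. with `x n` on `A n` for each `n`. -/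
def IsConcat (A : ℕ → Set Ω) (x : ℕ → Ω →ₘ[P] B) (y : Ω →ₘ[P] B) : Prop :=
  ∀ n, ∀ᵐ ω ∂P, ω ∈ A n → y ω = x n ω

/-- `G` is σ-stable: it contains all countable concatenations of its members along
countable measurable partitions of `Ω`. -/
def SigmaStable (G : Set (Ω →ₘ[P] B)) : Prop :=
  ∀ A : ℕ → Set Ω, IsPartition A → ∀ x : ℕ → Ω →ₘ[P] B, (∀ n, x n ∈ G) →
    ∀ y, IsConcat A x y → y ∈ G

/-- The σ-stable hull of `G`. -/
def sigmaHull (G : Set (Ω →ₘ[P] B)) : Set (Ω →ₘ[P] B) :=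
  {y | ∃ A : ℕ → Set Ω, IsPartition A ∧
    ∃ x : ℕ → Ω →ₘ[P] B, (∀ n, x n ∈ G) ∧ IsConcat A x y}

/-- The countable concatenation `Σ_n Ĩ_{A_n} H_n` of a sequence of sets. -/
def concatSet (A : ℕ → Set Ω) (H : ℕ → Set (Ω →ₘ[P] B)) : Set (Ω →ₘ[P] B) :=
  {y | ∃ x : ℕ → Ω →ₘ[P] B, (∀ n, x n ∈ H n) ∧ IsConcat A x y}

/-- A finitely stable subset of `L⁰(𝓕,B)`. -/
def FinStable (G : Set (Ω →ₘ[P] B)) : Prop :=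
  ∀ x ∈ G, ∀ y ∈ G, ∀ A : Set Ω, ∀ hA : MeasurableSet A,
    msmul (ind A hA) x + msmul (ind Aᶜ hA.compl) y ∈ G


theorem weaklyCompact_bdd {B : Type*} [NormedAddCommGroup B] [NormedSpace ℝ B]
    (V : Set B) (hV : WeaklyCompact V) : ∃ M : ℝ, ∀ v ∈ V, ‖v‖ ≤ M := by
  have key : ∀ f : StrongDual ℝ B, ∃ C, ∀ i : V,
      ‖(NormedSpace.inclusionInDoubleDual ℝ B (i : B)) f‖ ≤ C := by
    intro f
    have hc : Continuous (fun w : WeakSpace ℝ B => f ((toWeakSpace ℝ B).symm w)) :=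
      WeakBilin.eval_continuous (topDualPairing ℝ B).flip f
    obtain ⟨C, hC⟩ := (hV.image hc).isBounded.exists_norm_le
    refine ⟨C, fun i => ?_⟩
    rw [NormedSpace.dual_def]
    exact hC _ ⟨_, ⟨i, i.2, rfl⟩, rfl⟩
  obtain ⟨C, hC⟩ := banach_steinhaus key
  refine ⟨C, fun v hv => ?_⟩
  have := hC ⟨v, hv⟩
  have h2 := (NormedSpace.inclusionInDoubleDualLi (E := B) ℝ).norm_map v
  rw [← h2]
  exact this

theorem bdd_range {B : Type*} [NormedAddCommGroup B] [NormedSpace ℝ B]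
    {V : Set B} {M : ℝ} (hM : ∀ v ∈ V, ‖v‖ ≤ M) (x : B) :
    BddAbove (range fun y : V => ‖x - (y : B)‖) := by
  refine ⟨‖x‖ + M, ?_⟩
  rintro _ ⟨y, rfl⟩
  have := hM y y.2
  have := norm_sub_le x (y : B)
  simp only
  linarith

theorem supDist_le_add {B : Type*} [NormedAddCommGroup B] [NormedSpace ℝ B]
    {V : Set B} (hne : V.Nonempty) {M : ℝ} (hM : ∀ v ∈ V, ‖v‖ ≤ M) (x y : B) :
    supDist V x ≤ supDist V y + ‖x - y‖ := by
  haveI := hne.to_subtype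
  refine ciSup_le fun v => ?_
  have h1 : ‖y - (v : B)‖ ≤ supDist V y := le_ciSup (bdd_range hM y) v
  have h2 := norm_sub_le_norm_sub_add_norm_sub x y (v : B)
  linarith

theorem supDist_continuous {B : Type*} [NormedAddCommGroup B] [NormedSpace ℝ B]
    {V : Set B} (hne : V.Nonempty) {M : ℝ} (hM : ∀ v ∈ V, ‖v‖ ≤ M) :
    Continuous (supDist V) := by
  refine (LipschitzWith.of_le_add fun x y => ?_).continuous
  rw [dist_eq_norm]
  exact supDist_le_add hne hM x y

theorem lsup_eq {Ω : Type*} [MeasurableSpace Ω] {P : Measure Ω} {S : Set (Ω →ₘ[P] ℝ)}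
    {ξ : Ω →ₘ[P] ℝ} (h : IsLUB S ξ) : lsup S = ξ := by
  have h' : ∃ ξ, IsLUB S ξ := ⟨ξ, h⟩
  rw [lsup, dif_pos h']
  exact h'.choose_spec.unique h

theorem linf_eq {Ω : Type*} [MeasurableSpace Ω] {P : Measure Ω} {S : Set (Ω →ₘ[P] ℝ)}
    {ξ : Ω →ₘ[P] ℝ} (h : IsGLB S ξ) : linf S = ξ := by
  have h' : ∃ ξ, IsGLB S ξ := ⟨ξ, h⟩
  rw [linf, dif_pos h']
  exact h'.choose_spec.unique h

theorem nrm_sub_coe {Ω : Type*} [MeasurableSpace Ω] {P : Measure Ω}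
    {B : Type*} [NormedAddCommGroup B] [NormedSpace ℝ B] (x y : Ω →ₘ[P] B) :
    ∀ᵐ ω ∂P, nrm (x - y) ω = ‖x ω - y ω‖ := by
  filter_upwards [AEEqFun.coeFn_comp norm continuous_norm (x - y), AEEqFun.coeFn_sub x y]
    with ω h1 h2
  rw [nrm, h1, comp_apply, h2, Pi.sub_apply]

theorem Rr_isLUB {Ω : Type*} [MeasurableSpace Ω] {P : Measure Ω}
    {B : Type*} [NormedAddCommGroup B] [NormedSpace ℝ B]
    {V : Set B} (hne : V.Nonempty) {M : ℝ} (hM : ∀ v ∈ V, ‖v‖ ≤ M) (x : Ω →ₘ[P] B) :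
    IsLUB ((fun y => nrm (x - y)) '' {x : Ω →ₘ[P] B | ∀ᵐ ω ∂P, x ω ∈ V})
      (x.comp (supDist V) (supDist_continuous hne hM)) := by
  haveI := hne.to_subtype
  constructor
  · rintro _ ⟨y, hy, rfl⟩
    rw [← AEEqFun.coeFn_le]
    filter_upwards [nrm_sub_coe x y, hy,
      AEEqFun.coeFn_comp (supDist V) (supDist_continuous hne hM) x] with ω h1 h2 h3
    rw [h3, h1]
    exact le_ciSup (bdd_range hM (x ω)) ⟨y ω, h2⟩
  · intro ξ hξ
    rw [← AEEqFun.coeFn_le]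
    obtain ⟨t, ⟨C, hCc, htC⟩, hxt⟩ := x.aestronglyMeasurable.isSeparable_ae_range
    have hsel : ∀ (c : B) (n : ℕ), ∃ v : V, supDist V c - 1 / ((n : ℝ) + 1) < ‖c - (v : B)‖ := by
      intro c n
      apply exists_lt_of_lt_ciSup
      have : (0 : ℝ) < 1 / ((n : ℝ) + 1) := Nat.one_div_pos_of_nat
      change _ < supDist V c
      linarith
    choose v hv using hsel
    have hv' : ∀ c n, ∀ᵐ ω ∂P, ‖x ω - (v c n : B)‖ ≤ ξ ω := by
      intro c n
      have hmem : AEEqFun.const Ω (v c n : B) ∈ {x : Ω →ₘ[P] B | ∀ᵐ ω ∂P, x ω ∈ V} := by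
        filter_upwards [AEEqFun.coeFn_const (μ := P) Ω (v c n : B)] with ω hω
        rw [hω]; exact (v c n).2
      have h := hξ ⟨_, hmem, rfl⟩
      rw [← AEEqFun.coeFn_le] at h
      filter_upwards [h, nrm_sub_coe x (AEEqFun.const Ω (v c n : B)),
        AEEqFun.coeFn_const (μ := P) Ω (v c n : B)] with ω h1 h2 h3
      rw [h2, h3] at h1
      exact h1
    have hall : ∀ᵐ ω ∂P, ∀ c ∈ C, ∀ n, ‖x ω - (v c n : B)‖ ≤ ξ ω := by
      rw [ae_ball_iff hCc]
      intro c _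
      rw [ae_all_iff]
      exact hv' c
    filter_upwards [hall, hxt, AEEqFun.coeFn_comp (supDist V) (supDist_continuous hne hM) x]
      with ω h1 h2 h3
    rw [h3]
    refine le_of_forall_pos_le_add fun ε hε => ?_
    obtain ⟨c, hc, hxc⟩ := Metric.mem_closure_iff.1 (htC h2) (ε / 3) (by positivity)
    obtain ⟨n, hn⟩ := exists_nat_one_div_lt (show (0 : ℝ) < ε / 3 by positivity)
    rw [dist_eq_norm] at hxc
    have e1 := supDist_le_add hne hM (x ω) c
    have e2 := hv c n
    have e3 := norm_sub_le_norm_sub_add_norm_sub c (x ω) (v c n : B)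
    have e4 := h1 c hc n
    rw [norm_sub_rev c (x ω)] at e3
    simp only [comp_apply]
    linarith

/-- The random Chebyshev center of `L⁰(𝓕,V)` is `L⁰(𝓕,c(V,V))`:
`R(L⁰(𝓕,V), L⁰(𝓕,V))` is the constant function with value `r(V,V)`; for each
`x ∈ L⁰(𝓕,V)`, `R(L⁰(𝓕,V), x)` is the equivalence class of `ω ↦ sup_{v ∈ V} ‖x ω − v‖`;
and `x ∈ L⁰(𝓕,V)` lies in the random Chebyshev center iff `x ω ∈ c(V,V)` a.s. -/
theorem randomChebCenter_of_L0_eq_L0_of_chebCenter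
    {Ω : Type*} [MeasurableSpace Ω] {P : Measure Ω} [IsProbabilityMeasure P]
    {B : Type*} [NormedAddCommGroup B] [NormedSpace ℝ B] [CompleteSpace B]
    (V : Set B) (hVne : V.Nonempty) (hVconv : Convex ℝ V) (hVwc : WeaklyCompact V)
    (L0V : Set (Ω →ₘ[P] B)) (hL0V : L0V = {x : Ω →ₘ[P] B | ∀ᵐ ω ∂P, x ω ∈ V}) :
    RrS L0V L0V = AEEqFun.const Ω (chebRadius V) ∧
    (∀ x ∈ L0V, ∀ᵐ ω ∂P, (Rr L0V x) ω = supDist V (x ω)) ∧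
    (∀ x ∈ L0V, (x ∈ Cc L0V L0V ↔ ∀ᵐ ω ∂P, x ω ∈ chebCenter V)) := by
  subst hL0V
  obtain ⟨M, hM⟩ := weaklyCompact_bdd V hVwc
  haveI := hVne.to_subtype
  set L0V := {x : Ω →ₘ[P] B | ∀ᵐ ω ∂P, x ω ∈ V} with hL
  have hR : ∀ x : Ω →ₘ[P] B,
      Rr L0V x = x.comp (supDist V) (supDist_continuous hVne hM) :=
    fun x => lsup_eq (Rr_isLUB hVne hM x)
  have hR' : ∀ x : Ω →ₘ[P] B, ∀ᵐ ω ∂P, (Rr L0V x) ω = supDist V (x ω) := by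
    intro x
    rw [hR x]
    exact AEEqFun.coeFn_comp (supDist V) (supDist_continuous hVne hM) x
  have hbdd : BddBelow (range fun z : V => supDist V (z : B)) := by
    refine ⟨0, ?_⟩
    rintro _ ⟨z, rfl⟩
    exact Real.iSup_nonneg fun _ => norm_nonneg _
  have hS : RrS L0V L0V = AEEqFun.const Ω (chebRadius V) := by
    apply linf_eq
    constructor
    · rintro _ ⟨x, hx, rfl⟩
      rw [← AEEqFun.coeFn_le]
      filter_upwards [hR' x, hx, AEEqFun.coeFn_const (μ := P) Ω (chebRadius V)] with ω h1 h2 h3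
      rw [h1, h3]
      exact ciInf_le hbdd ⟨x ω, h2⟩
    · intro η hη
      rw [← AEEqFun.coeFn_le]
      have hz : ∀ n : ℕ, ∀ᵐ ω ∂P, η ω ≤ chebRadius V + 1 / ((n : ℝ) + 1) := by
        intro n
        have hpos : (0 : ℝ) < 1 / ((n : ℝ) + 1) := Nat.one_div_pos_of_nat
        obtain ⟨z, hz⟩ := exists_lt_of_ciInf_lt
          (show (⨅ z : V, supDist V (z : B)) < chebRadius V + 1 / ((n : ℝ) + 1) by
            change chebRadius V < _
            linarith)
        have hmem : AEEqFun.const Ω (z : B) ∈ L0V := by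
          change ∀ᵐ ω ∂P, _
          filter_upwards [AEEqFun.coeFn_const (μ := P) Ω (z : B)] with ω hω
          rw [hω]; exact z.2
        have h := hη ⟨_, hmem, rfl⟩
        rw [← AEEqFun.coeFn_le] at h
        filter_upwards [h, hR' (AEEqFun.const Ω (z : B)),
          AEEqFun.coeFn_const (μ := P) Ω (z : B)] with ω h1 h2 h3
        rw [h2, h3] at h1
        exact h1.trans hz.le
      rw [← ae_all_iff] at hz
      filter_upwards [hz, AEEqFun.coeFn_const (μ := P) Ω (chebRadius V)] with ω h1 h2
      rw [h2]
      refine le_of_forall_pos_le_add fun ε hε => ?_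
      obtain ⟨n, hn⟩ := exists_nat_one_div_lt hε
      have := h1 n
      simp only [const_apply]
      linarith
  refine ⟨hS, fun x _ => hR' x, fun x hx => ?_⟩
  have hx' : ∀ᵐ ω ∂P, x ω ∈ V := hx
  constructor
  · rintro ⟨_, h⟩
    rw [hS] at h
    have h0 := hR' x
    rw [h] at h0
    filter_upwards [h0, hx', AEEqFun.coeFn_const (μ := P) Ω (chebRadius V)] with ω h1 h2 h3
    rw [h3] at h1
    exact ⟨h2, h1.symm⟩
  · intro h
    refine ⟨hx, ?_⟩
    rw [hS]
    apply AEEqFun.ext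
    filter_upwards [h, hR' x, AEEqFun.coeFn_const (μ := P) Ω (chebRadius V)] with ω h1 h2 h3
    rw [h2, h3]
    exact h1.2

end RNM
end
end

section
/- Let G be a nonempty σ-stable subset of L⁰(𝓕) that has an upper bound in L⁰(𝓕), and let ξ := sup G (which exists in the Dedekind complete lattice L⁰(𝓕)). Then for every ε ∈ L⁰(𝓕) with ε(ω) > 0 for almost all ω, there exists g_ε ∈ G with g_ε(ω) > ξ(ω) − ε(ω) for almost all ω. Dually, if G has a lower bound in L⁰(𝓕) and η := inf G, then for every such ε there exists g_ε ∈ G with g_ε(ω) < η(ω) + ε(ω) for almost all ω. -/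
open MeasureTheory Set Filter Function
open scoped Classical

noncomputable section

namespace RNM


variable {Ω : Type*} [MeasurableSpace Ω] {P : Measure Ω}
variable {B : Type*} [NormedAddCommGroup B] [NormedSpace ℝ B]

/-- Gluing a sequence of members of a σ-stable set so as to satisfy a measurable
pointwise condition wherever some member of the sequence does. -/
theorem glue_aux {Ω : Type*} [MeasurableSpace Ω] {P : Measure Ω}
    (G : Set (Ω →ₘ[P] ℝ)) (hG : SigmaStable G) (p : Ω → ℝ → Prop)
    (hp : ∀ g : Ω →ₘ[P] ℝ, MeasurableSet {ω | p ω (g ω)})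
    (g : ℕ → Ω →ₘ[P] ℝ) (hg : ∀ n, g n ∈ G) :
    ∃ y ∈ G, ∀ᵐ ω ∂P, ∀ n, p ω (g n ω) → p ω (y ω) := by
  have hq : ∀ ω, ∃ n, p ω (g n ω) ∨ ∀ k, ¬ p ω (g k ω) := by
    intro ω
    by_cases h : ∃ n, p ω (g n ω)
    · exact h.imp fun n hn => Or.inl hn
    · exact ⟨0, Or.inr (not_exists.mp h)⟩
  let N : Ω → ℕ := fun ω => Nat.find (hq ω)
  have hN : Measurable N := by
    refine measurable_find hq fun k => ?_
    have h2 : MeasurableSet {ω | ∀ k, ¬ p ω (g k ω)} := by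
      have h3 : {ω | ∀ k, ¬ p ω (g k ω)} = ⋂ k, {ω | p ω (g k ω)}ᶜ := by
        ext ω
        simp
      rw [h3]
      exact MeasurableSet.iInter fun k => (hp (g k)).compl
    exact (hp (g k)).union h2
  have hf : Measurable fun ω => g (N ω) ω := by
    have h1 : Measurable fun x : Ω × ℕ => g x.2 x.1 :=
      measurable_from_prod_countable_left fun n => (g n).measurable
    exact h1.comp (measurable_id.prodMk hN)
  have hy := AEEqFun.coeFn_mk (μ := P) (fun ω => g (N ω) ω) hf.aestronglyMeasurable
  refine ⟨AEEqFun.mk (fun ω => g (N ω) ω) hf.aestronglyMeasurable,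
    hG (fun n => N ⁻¹' {n}) ⟨fun n => hN (measurableSet_singleton n), ?_, ?_⟩ g hg _ ?_, ?_⟩
  · intro i j hij
    refine Set.disjoint_left.mpr fun ω h1 h2 => hij ?_
    exact (show N ω = i from h1).symm.trans h2
  · ext ω
    simp
  · intro n
    filter_upwards [hy] with ω h1 h2
    have h3 : N ω = n := h2
    rw [h1, h3]
  · filter_upwards [hy] with ω h1 n hn
    rw [h1]
    rcases Nat.find_spec (hq ω) with h | h
    · exact h
    · exact absurd hn (h n)

/-- A member of a σ-stable set which satisfies a measurable pointwise condition on an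
essentially maximal set. -/
theorem max_aux {Ω : Type*} [MeasurableSpace Ω] {P : Measure Ω} [IsProbabilityMeasure P]
    (G : Set (Ω →ₘ[P] ℝ)) (hGne : G.Nonempty) (hG : SigmaStable G) (p : Ω → ℝ → Prop)
    (hp : ∀ g : Ω →ₘ[P] ℝ, MeasurableSet {ω | p ω (g ω)}) :
    ∃ y ∈ G, ∀ g ∈ G, ∀ᵐ ω ∂P, p ω (g ω) → p ω (y ω) := by
  let m : (Ω →ₘ[P] ℝ) → ENNReal := fun g => P {ω | p ω (g ω)}
  obtain ⟨u, -, hu, hum⟩ := exists_seq_tendsto_sSup (hGne.image m) (OrderTop.bddAbove _)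
  choose g hg hgu using hum
  obtain ⟨y, hyG, hy⟩ := glue_aux G hG p hp g hg
  have hsup : ∀ z ∈ G, m z ≤ m y := by
    intro z hz
    refine (le_sSup (mem_image_of_mem m hz)).trans (le_of_tendsto' hu fun n => ?_)
    rw [← hgu n]
    refine measure_mono_ae ?_
    filter_upwards [hy] with ω h1 h2
    exact h1 n h2
  refine ⟨y, hyG, fun z hz => ?_⟩
  obtain ⟨w, hwG, hw⟩ := glue_aux G hG p hp (fun n => if n = 0 then y else z)
    (fun n => by split_ifs <;> assumption)
  have hyw : {ω | p ω (y ω)} ≤ᵐ[P] {ω | p ω (w ω)} := by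
    filter_upwards [hw] with ω h1 h2
    have h3 : p ω (y ω) := h2
    exact h1 0 (by simpa using h3)
  have heq := ae_eq_of_ae_subset_of_measure_ge hyw (hsup w hwG)
    (hp y).nullMeasurableSet (measure_ne_top P _)
  filter_upwards [hw, heq.mem_iff] with ω h1 h2 h3
  exact h2.mpr (h1 1 (by simpa using h3))

/-- For a nonempty σ-stable subset `G` of `L⁰(𝓕,ℝ)`: if `ξ` is the supremum of `G`, then
for every `ε ∈ L⁰(𝓕)` with `ε > 0` a.s. there is `g ∈ G` with `g > ξ − ε` a.s.; dually
for the infimum. -/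
theorem sigmaStable_approx_sup_inf
    {Ω : Type*} [MeasurableSpace Ω] {P : Measure Ω} [IsProbabilityMeasure P]
    (G : Set (Ω →ₘ[P] ℝ)) (hGne : G.Nonempty) (hGstab : SigmaStable G) :
    (∀ ξ : Ω →ₘ[P] ℝ, IsLUB G ξ →
      ∀ ε : Ω →ₘ[P] ℝ, (∀ᵐ ω ∂P, 0 < ε ω) →
        ∃ g ∈ G, ∀ᵐ ω ∂P, ξ ω - ε ω < g ω) ∧
    (∀ η : Ω →ₘ[P] ℝ, IsGLB G η →
      ∀ ε : Ω →ₘ[P] ℝ, (∀ᵐ ω ∂P, 0 < ε ω) →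
        ∃ g ∈ G, ∀ᵐ ω ∂P, g ω < η ω + ε ω) := by
  constructor
  · intro ξ hξ ε hε
    obtain ⟨y, hyG, hy⟩ := max_aux G hGne hGstab (fun ω t => ξ ω - ε ω < t)
      (fun g => measurableSet_lt (ξ.measurable.sub ε.measurable) g.measurable)
    refine ⟨y, hyG, ?_⟩
    have hS : MeasurableSet {ω | ξ ω - ε ω < y ω} :=
      measurableSet_lt (ξ.measurable.sub ε.measurable) y.measurable
    have hf : Measurable fun ω => if ξ ω - ε ω < y ω then ξ ω else ξ ω - ε ω :=
      Measurable.ite hS ξ.measurable (ξ.measurable.sub ε.measurable)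
    have hc := AEEqFun.coeFn_mk (μ := P) _ hf.aestronglyMeasurable
    have hub : AEEqFun.mk _ hf.aestronglyMeasurable ∈ upperBounds G := by
      intro g hg
      rw [← AEEqFun.coeFn_le]
      filter_upwards [hc, hy g hg, AEEqFun.coeFn_le.mpr (hξ.1 hg)] with ω h1 h2 h3
      rw [h1]
      split_ifs with h
      · exact h3
      · exact not_lt.mp fun h4 => h (h2 h4)
    filter_upwards [hc, AEEqFun.coeFn_le.mpr (hξ.2 hub), hε] with ω h1 h2 h3
    rw [h1] at h2
    split_ifs at h2 with h
    · exact h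
    · linarith
  · intro η hη ε hε
    obtain ⟨y, hyG, hy⟩ := max_aux G hGne hGstab (fun ω t => t < η ω + ε ω)
      (fun g => measurableSet_lt g.measurable (η.measurable.add ε.measurable))
    refine ⟨y, hyG, ?_⟩
    have hS : MeasurableSet {ω | y ω < η ω + ε ω} :=
      measurableSet_lt y.measurable (η.measurable.add ε.measurable)
    have hf : Measurable fun ω => if y ω < η ω + ε ω then η ω else η ω + ε ω :=
      Measurable.ite hS η.measurable (η.measurable.add ε.measurable)
    have hc := AEEqFun.coeFn_mk (μ := P) _ hf.aestronglyMeasurable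
    have hub : AEEqFun.mk _ hf.aestronglyMeasurable ∈ lowerBounds G := by
      intro g hg
      rw [← AEEqFun.coeFn_le]
      filter_upwards [hc, hy g hg, AEEqFun.coeFn_le.mpr (hη.1 hg)] with ω h1 h2 h3
      rw [h1]
      split_ifs with h
      · exact h3
      · exact not_lt.mp fun h4 => h (h2 h4)
    filter_upwards [hc, AEEqFun.coeFn_le.mpr (hη.2 hub), hε] with ω h1 h2 h3
    rw [h1] at h2
    split_ifs at h2 with h
    · exact h
    · linarith

end RNM
end
end

section
/- Let H be an a.s. bounded nonempty subset of L⁰(𝓕,B) and G a nonempty finitely stable subset of L⁰(𝓕,B) with C(H,G) ≠ ∅. Then Ĩ_A C(H,G) = C(Ĩ_A H, Ĩ_A G) for every A ∈ 𝓕. Moreover, for every sequence (H_n) of a.s. bounded nonempty subsets of L⁰(𝓕,B), every sequence (G_n) of nonempty finitely stable subsets of L⁰(𝓕,B) with each C(H_n,G_n) ≠ ∅, and every countable measurable partition (A_n) of Ω, one has C(Σ_n Ĩ_{A_n}H_n, Σ_n Ĩ_{A_n}G_n) = Σ_n Ĩ_{A_n} C(H_n, G_n). -/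
open MeasureTheory Set Filter Function
open scoped Classical

noncomputable section

namespace RNM


variable {Ω : Type*} [MeasurableSpace Ω] {P : Measure Ω}
variable {B : Type*} [NormedAddCommGroup B] [NormedSpace ℝ B]

section helpers

theorem exists_lub [IsProbabilityMeasure P] (S : Set (Ω →ₘ[P] ℝ)) (hS : S.Nonempty)
    (hb : BddAbove S) : ∃ ξ, IsLUB S ξ := by
  obtain ⟨s0, hs0⟩ := hS
  obtain ⟨u, hu⟩ := hb
  set L : Set (Ω →ₘ[P] ℝ) := lowerBounds (upperBounds S) with hL
  have hSL : S ⊆ L := fun s hs v hv => hv hs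
  have hint : ∀ f : Ω →ₘ[P] ℝ, Integrable (fun ω => Real.arctan (f ω)) P := by
    intro f
    refine Integrable.of_bound (C := Real.pi / 2)
      (Real.continuous_arctan.comp_aestronglyMeasurable f.aestronglyMeasurable) ?_
    filter_upwards with ω
    rw [Real.norm_eq_abs, abs_le]
    exact ⟨(Real.neg_pi_div_two_lt_arctan _).le, (Real.arctan_lt_pi_div_two _).le⟩
  set J : (Ω →ₘ[P] ℝ) → ℝ := fun f => ∫ ω, Real.arctan (f ω) ∂P with hJ
  have hmono : ∀ f g : Ω →ₘ[P] ℝ, f ≤ g → J f ≤ J g := by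
    intro f g hfg
    refine integral_mono_ae (hint f) (hint g) ?_
    filter_upwards [AEEqFun.coeFn_le.2 hfg] with ω h
    exact Real.arctan_strictMono.monotone h
  have hbdd : BddAbove (J '' L) := by
    refine ⟨J u, ?_⟩
    rintro _ ⟨f, hf, rfl⟩
    exact hmono _ _ (hf hu)
  have hne : (J '' L).Nonempty := ⟨_, s0, hSL hs0, rfl⟩
  have hex : ∀ n : ℕ, ∃ f ∈ L, sSup (J '' L) - 1 / ((n : ℝ) + 1) < J f := by
    intro n
    have hpos : (0 : ℝ) < 1 / ((n : ℝ) + 1) := by positivity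
    obtain ⟨_, ⟨f, hf, rfl⟩, h⟩ := exists_lt_of_lt_csSup hne (sub_lt_self (sSup (J '' L)) hpos)
    exact ⟨f, hf, h⟩
  choose f hfL hf using hex
  have hm : Measurable (fun ω => ⨆ n, f n ω) := Measurable.iSup fun n => (f n).measurable
  set b : Ω →ₘ[P] ℝ := AEEqFun.mk (fun ω => ⨆ n, f n ω) hm.aestronglyMeasurable with hbdef
  have hbc : (b : Ω → ℝ) =ᵐ[P] fun ω => ⨆ n, f n ω := AEEqFun.coeFn_mk _ _
  have hle : ∀ v ∈ upperBounds S, ∀ᵐ ω ∂P, ∀ n, f n ω ≤ v ω := by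
    intro v hv
    exact ae_all_iff.2 fun n => AEEqFun.coeFn_le.2 (hfL n hv)
  have hbL : b ∈ L := by
    intro v hv
    rw [← AEEqFun.coeFn_le]
    filter_upwards [hbc, hle v hv] with ω h1 h2
    rw [h1]
    exact ciSup_le h2
  have hfb : ∀ n, f n ≤ b := by
    intro n
    rw [← AEEqFun.coeFn_le]
    filter_upwards [hbc, hle u hu] with ω h1 h2
    rw [h1]
    exact le_ciSup (f := fun n => f n ω) ⟨u ω, by rintro _ ⟨k, rfl⟩; exact h2 k⟩ n
  have hJb : sSup (J '' L) ≤ J b := by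
    refine le_of_forall_pos_lt_add fun ε hε => ?_
    obtain ⟨n, hn⟩ := exists_nat_one_div_lt hε
    have := hf n
    have := hmono _ _ (hfb n)
    linarith
  refine ⟨b, ?_, fun v hv => hbL hv⟩
  intro s hs
  have hsb : s ⊔ b ∈ L := fun v hv => sup_le (hv hs) (hbL hv)
  have h1 : J (s ⊔ b) ≤ J b := (le_csSup hbdd ⟨_, hsb, rfl⟩).trans hJb
  have h2 : J b = J (s ⊔ b) := le_antisymm (hmono _ _ le_sup_right) h1
  have h3 : (fun ω => Real.arctan (b ω)) ≤ᵐ[P] fun ω => Real.arctan ((s ⊔ b : Ω →ₘ[P] ℝ) ω) := by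
    filter_upwards [AEEqFun.coeFn_le.2 (le_sup_right : b ≤ s ⊔ b)] with ω h
    exact Real.arctan_strictMono.monotone h
  have h4 := (integral_eq_iff_of_ae_le (hint b) (hint (s ⊔ b)) h3).1 h2
  have h5 : s ⊔ b ≤ b := by
    rw [← AEEqFun.coeFn_le]
    filter_upwards [h4] with ω h
    exact (Real.arctan_injective h).ge
  exact le_sup_left.trans h5

theorem exists_glb [IsProbabilityMeasure P] (S : Set (Ω →ₘ[P] ℝ)) (hS : S.Nonempty)
    (hb : BddBelow S) : ∃ ξ, IsGLB S ξ := by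
  obtain ⟨ξ, h⟩ := exists_lub (lowerBounds S) hb (hS.mono fun s hs v hv => hv hs)
  exact ⟨ξ, isLUB_lowerBounds.1 h⟩

theorem lsup_isLUB [IsProbabilityMeasure P] (S : Set (Ω →ₘ[P] ℝ)) (hS : S.Nonempty)
    (hb : BddAbove S) : IsLUB S (lsup S) := by
  have h := exists_lub S hS hb
  rw [lsup, dif_pos h]
  exact h.choose_spec

theorem linf_isGLB {S : Set (Ω →ₘ[P] ℝ)} (h : ∃ ξ, IsGLB S ξ) : IsGLB S (linf S) := by
  rw [linf, dif_pos h]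
  exact h.choose_spec

theorem nrm_coe (x : Ω →ₘ[P] B) : (nrm x : Ω → ℝ) =ᵐ[P] fun ω => ‖x ω‖ :=
  AEEqFun.coeFn_comp _ _ _

theorem msmul_coe (A : Set Ω) (hA : MeasurableSet A) (x : Ω →ₘ[P] B) :
    (msmul (ind A hA) x : Ω → B) =ᵐ[P] A.indicator x := by
  have h1 : (msmul (ind A hA) x : Ω → B) =ᵐ[P] fun ω => (ind A hA : Ω →ₘ[P] ℝ) ω • x ω :=
    AEEqFun.coeFn_comp₂ _ _ _ _
  have h2 : ((ind A hA : Ω →ₘ[P] ℝ) : Ω → ℝ) =ᵐ[P] A.indicator fun _ => (1 : ℝ) :=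
    AEEqFun.coeFn_mk _ _
  filter_upwards [h1, h2] with ω h1 h2
  rw [h1, h2]
  by_cases h : ω ∈ A <;> simp [h]

theorem mix_coe (A : Set Ω) (hA : MeasurableSet A) (x y : Ω →ₘ[P] B) :
    ((msmul (ind A hA) x + msmul (ind Aᶜ hA.compl) y : Ω →ₘ[P] B) : Ω → B)
      =ᵐ[P] fun ω => if ω ∈ A then x ω else y ω := by
  filter_upwards [AEEqFun.coeFn_add (msmul (ind A hA) x) (msmul (ind Aᶜ hA.compl) y),
    msmul_coe A hA x, msmul_coe Aᶜ hA.compl y] with ω h1 h2 h3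
  rw [h1, Pi.add_apply, h2, h3]
  by_cases h : ω ∈ A <;> simp [h]

theorem exists_glue {E : Type*} [NormedAddCommGroup E] (A : ℕ → Set Ω) (hA : IsPartition A)
    (x : ℕ → Ω →ₘ[P] E) : ∃ y : Ω →ₘ[P] E, IsConcat A x y := by
  obtain ⟨hm, hd, hU⟩ := hA
  have hex : ∀ ω, ∃ n, ω ∈ A n := fun ω => by
    have : ω ∈ ⋃ n, A n := hU ▸ mem_univ ω
    simpa using this
  choose N hN using hex
  have hNeq : ∀ n, ∀ ω ∈ A n, N ω = n := by
    intro n ω hω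
    by_contra hne
    exact (Set.disjoint_left.1 (hd hne)) (hN ω) hω
  have hmeas : AEStronglyMeasurable (fun ω => x (N ω) ω) P := by
    have hPU : P.restrict (⋃ n, A n) = P := by rw [hU, Measure.restrict_univ]
    suffices hs : AEStronglyMeasurable (fun ω => x (N ω) ω) (P.restrict (⋃ n, A n)) from
      hs.mono_measure hPU.ge
    rw [aestronglyMeasurable_iUnion_iff]
    intro n
    refine (x n).aestronglyMeasurable.restrict.congr ?_
    filter_upwards [ae_restrict_mem (hm n)] with ω hω
    rw [hNeq n ω hω]
  refine ⟨AEEqFun.mk _ hmeas, fun n => ?_⟩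
  filter_upwards [AEEqFun.coeFn_mk _ hmeas] with ω h hω
  rw [h, hNeq n ω hω]

theorem rr_isLUB [IsProbabilityMeasure P] {H : Set (Ω →ₘ[P] B)} (hH : H.Nonempty)
    (hb : ASBounded H) (x : Ω →ₘ[P] B) :
    IsLUB ((fun y => nrm (x - y)) '' H) (Rr H x) := by
  refine lsup_isLUB _ (hH.image _) ?_
  obtain ⟨ξ, hξ⟩ := hb
  refine ⟨nrm x + ξ, ?_⟩
  rintro _ ⟨y, hy, rfl⟩
  rw [← AEEqFun.coeFn_le]
  filter_upwards [nrm_coe (x - y), nrm_coe x, nrm_coe y, AEEqFun.coeFn_le.2 (hξ y hy),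
    AEEqFun.coeFn_sub x y, AEEqFun.coeFn_add (nrm x) ξ] with ω h1 h2 h3 h4 h5 h6
  simp only [h1, h5, h6, Pi.sub_apply, Pi.add_apply, h2]
  have := norm_sub_le (x ω) (y ω)
  linarith

/-- Locality of the random Chebyshev radius. -/
theorem rr_local [IsProbabilityMeasure P] {H H' : Set (Ω →ₘ[P] B)} (hH : H.Nonempty)
    (hb : ASBounded H) (hH' : H'.Nonempty) (hb' : ASBounded H') {x x' : Ω →ₘ[P] B}
    {A : Set Ω} (hA : MeasurableSet A) (hx : ∀ᵐ ω ∂P, ω ∈ A → x ω = x' ω)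
    (hy : ∀ y ∈ H, ∃ y' ∈ H', ∀ᵐ ω ∂P, ω ∈ A → y ω = y' ω) :
    ∀ᵐ ω ∂P, ω ∈ A → Rr H x ω ≤ Rr H' x' ω := by
  have h1 := rr_isLUB hH hb x
  have h2 := rr_isLUB hH' hb' x'
  have hc := mix_coe A hA (Rr H' x') (Rr H x)
  set η : Ω →ₘ[P] ℝ := msmul (ind A hA) (Rr H' x') + msmul (ind Aᶜ hA.compl) (Rr H x)
  have hle : Rr H x ≤ η := by
    refine h1.2 ?_
    rintro _ ⟨y, hyH, rfl⟩
    obtain ⟨y', hy'H, hyy⟩ := hy y hyH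
    rw [← AEEqFun.coeFn_le]
    filter_upwards [hc, hx, hyy, nrm_coe (x - y), nrm_coe (x' - y'), AEEqFun.coeFn_sub x y,
      AEEqFun.coeFn_sub x' y', AEEqFun.coeFn_le.2 (h1.1 ⟨y, hyH, rfl⟩),
      AEEqFun.coeFn_le.2 (h2.1 ⟨y', hy'H, rfl⟩)] with ω e1 e2 e3 e4 e5 e6 e7 e8 e9
    rw [e1]
    by_cases h : ω ∈ A
    · simp only [h, if_true]
      refine le_trans (le_of_eq ?_) e9
      simp only [e4, e5, e6, e7, Pi.sub_apply, e2 h, e3 h]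
    · simp only [h, if_false]
      exact e8
  filter_upwards [AEEqFun.coeFn_le.2 hle, hc] with ω h1 h2 h
  rw [h2, if_pos h] at h1
  exact h1

theorem mem_Cc [IsProbabilityMeasure P] {H G : Set (Ω →ₘ[P] B)} (hH : H.Nonempty)
    (hb : ASBounded H) {x : Ω →ₘ[P] B} :
    x ∈ Cc H G ↔ x ∈ G ∧ ∀ g ∈ G, Rr H x ≤ Rr H g := by
  constructor
  · rintro ⟨hx, he⟩
    refine ⟨hx, fun g hg => ?_⟩
    rw [he]
    have hne : ((fun x => Rr H x) '' G).Nonempty := ⟨_, x, hx, rfl⟩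
    refine (linf_isGLB (exists_glb _ hne ⟨0, ?_⟩)).1 ⟨g, hg, rfl⟩
    rintro _ ⟨z, hz, rfl⟩
    obtain ⟨y, hy⟩ := hH
    refine le_trans ?_ ((rr_isLUB ⟨y, hy⟩ hb z).1 ⟨y, hy, rfl⟩)
    rw [← AEEqFun.coeFn_le]
    filter_upwards [nrm_coe (z - y), AEEqFun.coeFn_zero (α := Ω) (μ := P) (β := ℝ)] with ω h1 h2
    simp only [h1, h2]
    exact norm_nonneg _
  · rintro ⟨hx, hmin⟩
    have hl : IsLeast ((fun x => Rr H x) '' G) (Rr H x) :=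
      ⟨⟨x, hx, rfl⟩, by rintro _ ⟨g, hg, rfl⟩; exact hmin g hg⟩
    exact ⟨hx, hl.isGLB.unique (linf_isGLB ⟨_, hl.isGLB⟩)⟩

theorem le_of_parts {a b : Ω →ₘ[P] ℝ} (A : Set Ω) (h1 : ∀ᵐ ω ∂P, ω ∈ A → a ω ≤ b ω)
    (h2 : ∀ᵐ ω ∂P, ω ∈ Aᶜ → a ω ≤ b ω) : a ≤ b := by
  rw [← AEEqFun.coeFn_le]
  filter_upwards [h1, h2] with ω h1 h2
  by_cases h : ω ∈ A
  · exact h1 h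
  · exact h2 h

theorem trans_on {A : Set Ω} {a b c : Ω →ₘ[P] ℝ} (h1 : ∀ᵐ ω ∂P, ω ∈ A → a ω ≤ b ω)
    (h2 : ∀ᵐ ω ∂P, ω ∈ A → b ω ≤ c ω) : ∀ᵐ ω ∂P, ω ∈ A → a ω ≤ c ω := by
  filter_upwards [h1, h2] with ω h1 h2 h
  exact (h1 h).trans (h2 h)

theorem on_of_le {A : Set Ω} {a b : Ω →ₘ[P] ℝ} (h : a ≤ b) :
    ∀ᵐ ω ∂P, ω ∈ A → a ω ≤ b ω := by
  filter_upwards [AEEqFun.coeFn_le.2 h] with ω h1 _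
  exact h1

theorem symm_on {E : Type*} {A : Set Ω} {a b : Ω → E} (h : ∀ᵐ ω ∂P, ω ∈ A → a ω = b ω) :
    ∀ᵐ ω ∂P, ω ∈ A → b ω = a ω := by
  filter_upwards [h] with ω h1 h2
  exact (h1 h2).symm

theorem msmul_on (A : Set Ω) (hA : MeasurableSet A) (x : Ω →ₘ[P] B) :
    ∀ᵐ ω ∂P, ω ∈ A → msmul (ind A hA) x ω = x ω := by
  filter_upwards [msmul_coe A hA x] with ω h h1
  rw [h, indicator_of_mem h1]

theorem msmul_off (A : Set Ω) (hA : MeasurableSet A) (x y : Ω →ₘ[P] B) :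
    ∀ᵐ ω ∂P, ω ∈ Aᶜ → msmul (ind A hA) x ω = msmul (ind A hA) y ω := by
  filter_upwards [msmul_coe A hA x, msmul_coe A hA y] with ω h h' h1
  rw [h, h', indicator_of_notMem h1, indicator_of_notMem h1]

theorem mix_on (A : Set Ω) (hA : MeasurableSet A) (x y : Ω →ₘ[P] B) :
    ∀ᵐ ω ∂P, ω ∈ A →
      (msmul (ind A hA) x + msmul (ind Aᶜ hA.compl) y : Ω →ₘ[P] B) ω = x ω := by
  filter_upwards [mix_coe A hA x y] with ω h h1
  rw [h, if_pos h1]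

theorem mix_off (A : Set Ω) (hA : MeasurableSet A) (x y : Ω →ₘ[P] B) :
    ∀ᵐ ω ∂P, ω ∈ Aᶜ →
      (msmul (ind A hA) x + msmul (ind Aᶜ hA.compl) y : Ω →ₘ[P] B) ω = y ω := by
  filter_upwards [mix_coe A hA x y] with ω h h1
  rw [h, if_neg h1]

theorem part_one [IsProbabilityMeasure P] (H : Set (Ω →ₘ[P] B)) (hH : H.Nonempty)
    (hb : ASBounded H) (G : Set (Ω →ₘ[P] B)) (hG : FinStable G) (hC : (Cc H G).Nonempty)
    (A : Set Ω) (hA : MeasurableSet A) :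
    msmul (ind A hA) '' Cc H G = Cc (msmul (ind A hA) '' H) (msmul (ind A hA) '' G) := by
  have hH' : (msmul (ind A hA) '' H).Nonempty := hH.image _
  have hb' : ASBounded (msmul (ind A hA) '' H) := by
    obtain ⟨ξ, hξ⟩ := hb
    refine ⟨ξ, ?_⟩
    rintro _ ⟨y, hy, rfl⟩
    refine le_trans ?_ (hξ y hy)
    rw [← AEEqFun.coeFn_le]
    filter_upwards [nrm_coe (msmul (ind A hA) y), nrm_coe y, msmul_coe A hA y] with ω h1 h2 h3
    rw [h1, h2, h3]
    exact norm_indicator_le_norm_self _ _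
  have down : ∀ x z : Ω →ₘ[P] B, (∀ᵐ ω ∂P, ω ∈ A → x ω = z ω) →
      ∀ᵐ ω ∂P, ω ∈ A → Rr (msmul (ind A hA) '' H) x ω ≤ Rr H z ω := by
    intro x z hxz
    refine rr_local hH' hb' hH hb hA hxz ?_
    rintro _ ⟨y, hy, rfl⟩
    exact ⟨y, hy, msmul_on A hA y⟩
  have up : ∀ x z : Ω →ₘ[P] B, (∀ᵐ ω ∂P, ω ∈ A → x ω = z ω) →
      ∀ᵐ ω ∂P, ω ∈ A → Rr H x ω ≤ Rr (msmul (ind A hA) '' H) z ω := by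
    intro x z hxz
    refine rr_local hH hb hH' hb' hA hxz ?_
    intro y hy
    exact ⟨_, ⟨y, hy, rfl⟩, symm_on (msmul_on A hA y)⟩
  ext z
  rw [mem_Cc hH' hb']
  constructor
  · rintro ⟨x, hx, rfl⟩
    obtain ⟨hxG, hmin⟩ := (mem_Cc hH hb).1 hx
    refine ⟨⟨x, hxG, rfl⟩, ?_⟩
    rintro _ ⟨g, hg, rfl⟩
    refine le_of_parts A ?_ ?_
    · exact trans_on (down _ x (msmul_on A hA x))
        (trans_on (on_of_le (hmin g hg)) (up _ _ (symm_on (msmul_on A hA g))))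
    · refine rr_local hH' hb' hH' hb' hA.compl (msmul_off A hA x g) ?_
      intro y hy
      exact ⟨y, hy, ae_of_all _ fun _ _ => rfl⟩
  · rintro ⟨⟨x, hxG, rfl⟩, hmin⟩
    obtain ⟨x0, hx0⟩ := hC
    obtain ⟨hx0G, hmin0⟩ := (mem_Cc hH hb).1 hx0
    have hon := mix_on A hA x x0
    have hoff := mix_off A hA x x0
    have hwG := hG x hxG x0 hx0G A hA
    set w := msmul (ind A hA) x + msmul (ind Aᶜ hA.compl) x0
    refine ⟨w, (mem_Cc hH hb).2 ⟨hwG, fun g hg => le_of_parts A ?_ ?_⟩, ?_⟩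
    · refine trans_on (up w (msmul (ind A hA) x) ?_)
        (trans_on (on_of_le (hmin _ ⟨g, hg, rfl⟩)) (down _ g (msmul_on A hA g)))
      filter_upwards [hon, msmul_on A hA x] with ω h1 h2 h
      rw [h1 h, h2 h]
    · refine trans_on (rr_local hH hb hH hb hA.compl hoff ?_) (on_of_le (hmin0 g hg))
      intro y hy
      exact ⟨y, hy, ae_of_all _ fun _ _ => rfl⟩
    · apply AEEqFun.ext
      filter_upwards [msmul_coe A hA w, msmul_coe A hA x, hon] with ω h1 h2 h3
      rw [h1, h2]
      by_cases h : ω ∈ A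
      · rw [indicator_of_mem h, indicator_of_mem h, h3 h]
      · rw [indicator_of_notMem h, indicator_of_notMem h]

theorem part_two [IsProbabilityMeasure P] (A : ℕ → Set Ω) (hA : IsPartition A)
    (H : ℕ → Set (Ω →ₘ[P] B)) (hH : ∀ n, (H n).Nonempty) (hb : ∀ n, ASBounded (H n))
    (G : ℕ → Set (Ω →ₘ[P] B)) (hG : ∀ n, FinStable (G n))
    (hC : ∀ n, (Cc (H n) (G n)).Nonempty) :
    Cc (concatSet A H) (concatSet A G) = concatSet A (fun n => Cc (H n) (G n)) := by
  have ext_one : ∀ (K : ℕ → Set (Ω →ₘ[P] B)), (∀ n, (K n).Nonempty) → ∀ n, ∀ y ∈ K n,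
      ∃ y' ∈ concatSet A K, ∀ᵐ ω ∂P, ω ∈ A n → y ω = y' ω := by
    intro K hK n y hy
    choose k hk using hK
    obtain ⟨y', hy'⟩ := exists_glue A hA (Function.update k n y)
    refine ⟨y', ⟨_, ?_, hy'⟩, ?_⟩
    · intro m
      by_cases h : m = n
      · subst h; simpa using hy
      · simpa [h] using hk m
    · have := hy' n
      simp only [Function.update_self] at this
      exact symm_on this
  have le_parts : ∀ a b : Ω →ₘ[P] ℝ, (∀ n, ∀ᵐ ω ∂P, ω ∈ A n → a ω ≤ b ω) → a ≤ b := by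
    intro a b h
    rw [← AEEqFun.coeFn_le]
    filter_upwards [ae_all_iff.2 h] with ω h
    have : ω ∈ ⋃ n, A n := hA.2.2 ▸ mem_univ ω
    obtain ⟨n, hn⟩ := mem_iUnion.1 this
    exact h n hn
  have hH' : (concatSet A H).Nonempty := by
    obtain ⟨y, hy⟩ := hH 0
    obtain ⟨y', hy', _⟩ := ext_one H hH 0 y hy
    exact ⟨y', hy'⟩
  have hb' : ASBounded (concatSet A H) := by
    choose ξ hξ using hb
    obtain ⟨η, hη⟩ := exists_glue A hA ξ
    refine ⟨η, ?_⟩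
    rintro y ⟨x, hx, hxy⟩
    refine le_parts _ _ fun n => ?_
    filter_upwards [hη n, hxy n, nrm_coe y, nrm_coe (x n),
      AEEqFun.coeFn_le.2 (hξ n _ (hx n))] with ω h1 h2 h3 h4 h5 h
    rw [h1 h, h3, h2 h, ← h4]
    exact h5
  have down : ∀ n, ∀ x z : Ω →ₘ[P] B, (∀ᵐ ω ∂P, ω ∈ A n → x ω = z ω) →
      ∀ᵐ ω ∂P, ω ∈ A n → Rr (concatSet A H) x ω ≤ Rr (H n) z ω := by
    intro n x z hxz
    refine rr_local hH' hb' (hH n) (hb n) (hA.1 n) hxz ?_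
    rintro y ⟨k, hk, hky⟩
    exact ⟨k n, hk n, hky n⟩
  have up : ∀ n, ∀ x z : Ω →ₘ[P] B, (∀ᵐ ω ∂P, ω ∈ A n → x ω = z ω) →
      ∀ᵐ ω ∂P, ω ∈ A n → Rr (H n) x ω ≤ Rr (concatSet A H) z ω := by
    intro n x z hxz
    exact rr_local (hH n) (hb n) hH' hb' (hA.1 n) hxz (ext_one H hH n)
  have hGne : ∀ n, (G n).Nonempty := fun n => (hC n).mono fun _ h => h.1
  ext y
  rw [mem_Cc hH' hb']
  constructor
  · rintro ⟨⟨x, hxG, hxy⟩, hmin⟩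
    choose x0 hx0 using hC
    refine ⟨fun n => msmul (ind (A n) (hA.1 n)) (x n)
      + msmul (ind (A n)ᶜ (hA.1 n).compl) (x0 n), fun n => ?_, fun n => ?_⟩
    · obtain ⟨hx0G, hmin0⟩ := (mem_Cc (hH n) (hb n)).1 (hx0 n)
      have hon := mix_on (A n) (hA.1 n) (x n) (x0 n)
      refine (mem_Cc (hH n) (hb n)).2 ⟨hG n _ (hxG n) _ hx0G _ (hA.1 n), fun g hg =>
        le_of_parts (A n) ?_ ?_⟩
      · obtain ⟨g', hg', hgg⟩ := ext_one G hGne n g hg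
        refine trans_on (up n _ y ?_)
          (trans_on (on_of_le (hmin g' hg')) (down n g' g (symm_on hgg)))
        filter_upwards [hon, hxy n] with ω h1 h2 h
        rw [h1 h, h2 h]
      · refine trans_on (rr_local (hH n) (hb n) (hH n) (hb n) (hA.1 n).compl
          (mix_off (A n) (hA.1 n) (x n) (x0 n)) ?_) (on_of_le (hmin0 g hg))
        intro y hy
        exact ⟨y, hy, ae_of_all _ fun _ _ => rfl⟩
    · filter_upwards [mix_on (A n) (hA.1 n) (x n) (x0 n), hxy n] with ω h1 h2 h
      rw [h1 h, h2 h]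
  · rintro ⟨x, hx, hxy⟩
    refine ⟨⟨x, fun n => (hx n).1, hxy⟩, ?_⟩
    rintro g ⟨k, hk, hkg⟩
    refine le_parts _ _ fun n => ?_
    exact trans_on (down n y (x n) (hxy n))
      (trans_on (on_of_le (((mem_Cc (hH n) (hb n)).1 (hx n)).2 _ (hk n)))
        (up n _ _ (symm_on (hkg n))))

end helpers

/-- `Ĩ_A C(H,G) = C(Ĩ_A H, Ĩ_A G)` for finitely stable `G` with nonempty `C(H,G)`, and `C`
commutes with countable concatenations along countable measurable partitions of `Ω`. -/
theorem Cc_indicator_and_concat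
    {Ω : Type*} [MeasurableSpace Ω] {P : Measure Ω} [IsProbabilityMeasure P]
    {B : Type*} [NormedAddCommGroup B] [NormedSpace ℝ B] [CompleteSpace B] :
    (∀ H : Set (Ω →ₘ[P] B), H.Nonempty → ASBounded H →
      ∀ G : Set (Ω →ₘ[P] B), G.Nonempty → FinStable G → (Cc H G).Nonempty →
      ∀ A : Set Ω, ∀ hA : MeasurableSet A,
        msmul (ind A hA) '' Cc H G = Cc (msmul (ind A hA) '' H) (msmul (ind A hA) '' G)) ∧
    (∀ A : ℕ → Set Ω, IsPartition A →
      ∀ H : ℕ → Set (Ω →ₘ[P] B), (∀ n, (H n).Nonempty) → (∀ n, ASBounded (H n)) →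
      ∀ G : ℕ → Set (Ω →ₘ[P] B), (∀ n, (G n).Nonempty) → (∀ n, FinStable (G n)) →
        (∀ n, (Cc (H n) (G n)).Nonempty) →
        Cc (concatSet A H) (concatSet A G) = concatSet A (fun n => Cc (H n) (G n))) := by
  refine ⟨?_, ?_⟩
  · intro H hH hb G _ hG hC A hA
    exact part_one H hH hb G hG hC A hA
  · intro A hA H hH hb G _ hG hC
    exact part_two A hA H hH hb G hG hC

end RNM
end
end
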